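/- arXiv:1109.1456 — 8 statements merged into one kernel-verified Lean document; each statement's English description precedes it below -/
import Mathlib

section
/- Let E be a smooth homogeneous cubic in S = ℂ[z₀,…,z₄] and V = {E = 0} ⊆ ℂ^5. Let l_s be a special line (i.e. dim_ℂ J_2|_{l_s} = 2) not contained in V (E does not vanish identically on l_s), and assume l_s contains no Eckardt point, i.e. for every nonzero p ∈ l_s with E(p) = 0, the set of lines contained in V passing through p is finite. Then the set D_s of lines contained in V that meet l_s is finite. -/
open MvPolynomial Module

noncomputable section

/-- The Jacobian ideal of a polynomial `E`, generated by its five partial derivatives. -/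
def jacobianIdeal (E : MvPolynomial (Fin 5) ℂ) : Ideal (MvPolynomial (Fin 5) ℂ) :=
  Ideal.span (Set.range fun i => pderiv i E)

/-- `E` is a smooth cubic: it is homogeneous of degree 3 and the only common zero of its
partial derivatives is the origin. -/
def IsSmoothCubic (E : MvPolynomial (Fin 5) ℂ) : Prop :=
  E.IsHomogeneous 3 ∧ ∀ x : Fin 5 → ℂ, (∀ i, eval x (pderiv i E) = 0) → x = 0

/-- A linear subspace `l ⊆ ℂ⁵` lies in the cubic `V = {E = 0}` if `E` vanishes on it. -/
def SubsetV (E : MvPolynomial (Fin 5) ℂ) (l : Submodule ℂ (Fin 5 → ℂ)) : Prop :=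
  ∀ x ∈ l, eval x E = 0

/-- Restriction of polynomials to (the points of) a subspace `l ⊆ ℂ⁵`, as functions on `l`. -/
def restrictTo (l : Submodule ℂ (Fin 5 → ℂ)) :
    MvPolynomial (Fin 5) ℂ →ₗ[ℂ] (l → ℂ) :=
  LinearMap.pi fun x => (aeval (x : Fin 5 → ℂ)).toLinearMap

/-- The degree-2 part `J₂ = J ∩ S²` of the Jacobian ideal. -/
def J2 (E : MvPolynomial (Fin 5) ℂ) : Submodule ℂ (MvPolynomial (Fin 5) ℂ) :=
  (jacobianIdeal E).restrictScalars ℂ ⊓ homogeneousSubmodule (Fin 5) ℂ 2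

/-- A two-dimensional subspace containing `a ≠ 0` is spanned by `a` and a further vector `b`. -/
lemma exists_span_pair_eq {K M : Type*} [Field K] [AddCommGroup M] [Module K M]
    {l : Submodule K M} (hl : finrank K l = 2) {a : M} (ha : a ∈ l) (ha0 : a ≠ 0) :
    ∃ b, LinearIndependent K ![a, b] ∧ Submodule.span K {a, b} = l := by
  have : Module.Finite K l := Module.finite_of_finrank_pos (by omega)
  have hlt : Submodule.span K {a} < l := by
    refine lt_of_le_of_ne (by simpa using ha) fun h => ?_
    have h1 := finrank_span_singleton (K := K) ha0
    rw [h, hl] at h1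
    omega
  obtain ⟨b, hb, hba⟩ := SetLike.exists_of_lt hlt
  have hli : LinearIndependent K ![a, b] := by
    rw [LinearIndependent.pair_iff' ha0]
    intro c hc
    exact hba (hc ▸ Submodule.smul_mem _ c (Submodule.mem_span_singleton_self a))
  refine ⟨b, hli, Submodule.eq_of_le_of_finrank_eq ?_ ?_⟩
  · rw [Submodule.span_le]
    rintro x (rfl | rfl)
    exacts [ha, hb]
  · have h2 := finrank_span_eq_card hli
    rw [Matrix.range_cons, Matrix.range_cons, Matrix.range_empty, Set.union_empty,
      Set.singleton_union] at h2
    rw [h2, hl, Fintype.card_fin]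

/-- A polynomial that does not vanish at `a` has only finitely many zeros on the affine line
`a + K b`. -/
lemma finite_setOf_eval_add_smul_eq_zero {K σ : Type*} [Field K] (E : MvPolynomial σ K)
    (a b : σ → K) (ha : eval a E ≠ 0) : {s : K | eval (a + s • b) E = 0}.Finite := by
  set h : Polynomial K :=
    aeval (fun i => Polynomial.C (a i) + Polynomial.X * Polynomial.C (b i)) E with hh
  have heval (s : K) : h.eval s = eval (a + s • b) E := by
    rw [hh, ← Polynomial.coe_aeval_eq_eval, comp_aeval_apply, ← coe_aeval_eq_eval,
      RingHom.coe_coe]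
    congr 2
    ext i
    simpa using mul_comm (b i) s
  have h0 : h ≠ 0 := fun h0 => ha (by simpa [h0] using (heval 0).symm)
  refine (Polynomial.finite_setOfPred_isRoot h0).subset fun s hs => ?_
  exact (heval s).trans hs

/-- Let `l_s` be a special line (`dim J₂|_{l_s} = 2`) not contained in `V` and containing no
Eckardt point (through every point of `V ∩ l_s` there are only finitely many lines of `V`).
Then only finitely many lines of `V` meet `l_s`. -/
theorem statement10 (E : MvPolynomial (Fin 5) ℂ) (hE : IsSmoothCubic E)
    (ls : Submodule ℂ (Fin 5 → ℂ)) (hls : finrank ℂ ls = 2)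
    (hspecial : finrank ℂ (Submodule.map (restrictTo ls) (J2 E)) = 2)
    (hnotV : ¬ SubsetV E ls)
    (hEckardt : ∀ p : Fin 5 → ℂ, p ≠ 0 → p ∈ ls → eval p E = 0 →
      {m : Submodule ℂ (Fin 5 → ℂ) |
        finrank ℂ m = 2 ∧ SubsetV E m ∧ p ∈ m}.Finite) :
    {m : Submodule ℂ (Fin 5 → ℂ) |
      finrank ℂ m = 2 ∧ SubsetV E m ∧ m ⊓ ls ≠ ⊥}.Finite := by
  obtain ⟨a, ha, hEa⟩ : ∃ a ∈ ls, eval a E ≠ 0 := by simpa [SubsetV] using hnotV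
  have ha0 : a ≠ 0 := by
    rintro rfl
    rw [eval_zero, constantCoeff_eq] at hEa
    exact hEa (hE.1.coeff_eq_zero (by simp))
  obtain ⟨b, hli, hspan⟩ := exists_span_pair_eq hls ha ha0
  have hb : b ∈ ls := hspan ▸ Submodule.subset_span (by simp)
  have hfin (p : Fin 5 → ℂ) (hp0 : p ≠ 0) (hp : p ∈ ls) :
      {m : Submodule ℂ (Fin 5 → ℂ) | finrank ℂ m = 2 ∧ SubsetV E m ∧ p ∈ m}.Finite := by
    by_cases hEp : eval p E = 0
    · exact hEckardt p hp0 hp hEp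
    · convert Set.finite_empty
      ext m
      simp only [Set.mem_ofPred_eq, Set.mem_empty_iff_false, iff_false]
      exact fun ⟨_, hm, hpm⟩ => hEp (hm p hpm)
  have hadd (s : ℂ) : a + s • b ≠ 0 := fun h =>
    one_ne_zero (LinearIndependent.pair_iff.1 hli 1 s (by simpa using h)).1
  refine ((hfin b (hli.ne_zero 1) hb).union
    ((finite_setOf_eval_add_smul_eq_zero E a b hEa).biUnion fun s _ =>
      hfin (a + s • b) (hadd s) (ls.add_mem ha (ls.smul_mem s hb)))).subset ?_
  rintro m ⟨hm2, hmV, hmeet⟩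
  obtain ⟨x, ⟨hxm, hxl⟩, hx0⟩ := Submodule.exists_mem_ne_zero_of_ne_bot hmeet
  rw [SetLike.mem_coe, ← hspan, Submodule.mem_span_pair] at hxl
  obtain ⟨u, v, rfl⟩ := hxl
  by_cases hu : u = 0
  · subst hu
    rw [zero_smul, zero_add] at hxm hx0
    have hv : v ≠ 0 := fun h => hx0 (by rw [h, zero_smul])
    exact Or.inl ⟨hm2, hmV, (m.smul_mem_iff hv).1 hxm⟩
  · have hmem : a + (u⁻¹ * v) • b ∈ m := by
      simpa [smul_smul, hu] using m.smul_mem u⁻¹ hxm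
    exact Or.inr (Set.mem_biUnion (hmV _ hmem) ⟨hm2, hmV, hmem⟩)
end
end

section
/- Let E be a smooth homogeneous cubic in S = ℂ[z₀,…,z₄] and let l ⊆ ℂ^5 be a line contained in V = {E = 0}. Then l is special (dim_ℂ J_2|_l = 2) if and only if there is a plane tangent to V along l, i.e. there exist a plane P ⊇ l and a nonzero linear form h on P vanishing on l such that the restriction E|_P is divisible by h² in the ring of polynomial functions on P. -/
open MvPolynomial Module

noncomputable section

/-- The linear map sending a vector `v` to the derivative of `E` in the direction `v`. -/
def dirDeriv (E : MvPolynomial (Fin 5) ℂ) :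
    (Fin 5 → ℂ) →ₗ[ℂ] MvPolynomial (Fin 5) ℂ :=
  Fintype.linearCombination ℂ fun i => pderiv i E

lemma eval_dirDeriv (E : MvPolynomial (Fin 5) ℂ) (v x : Fin 5 → ℂ) :
    eval x (dirDeriv E v) = ∑ i, v i * eval x (pderiv i E) := by
  simp [dirDeriv, Fintype.linearCombination_apply, smul_eval]

lemma eval_dirDeriv_add (p q : MvPolynomial (Fin 5) ℂ) (v x : Fin 5 → ℂ) :
    eval x (dirDeriv (p + q) v) = eval x (dirDeriv p v) + eval x (dirDeriv q v) := by
  simp [eval_dirDeriv, mul_add, Finset.sum_add_distrib]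

lemma eval_dirDeriv_mul (p q : MvPolynomial (Fin 5) ℂ) (v x : Fin 5 → ℂ) :
    eval x (dirDeriv (p * q) v) =
      eval x p * eval x (dirDeriv q v) + eval x (dirDeriv p v) * eval x q := by
  simp only [eval_dirDeriv, Derivation.leibniz, smul_eq_mul, map_add, map_mul,
    Finset.mul_sum, Finset.sum_mul, ← Finset.sum_add_distrib]
  exact Finset.sum_congr rfl fun i _ => by ring

lemma dirDeriv_isHomogeneous {E : MvPolynomial (Fin 5) ℂ} {n : ℕ} (hE : E.IsHomogeneous n)
    (v : Fin 5 → ℂ) : (dirDeriv E v).IsHomogeneous (n - 1) := by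
  rw [dirDeriv, Fintype.linearCombination_apply]
  refine IsHomogeneous.sum _ _ _ fun i _ => ?_
  rw [smul_eq_C_mul]
  exact hE.pderiv.C_mul _

lemma eval_linear_expansion {p : MvPolynomial (Fin 5) ℂ} (hp : p.IsHomogeneous 1)
    (x v : Fin 5 → ℂ) :
    eval (x + v) p = eval x p + eval v p ∧ eval x (dirDeriv p v) = eval v p := by
  rw [← mem_homogeneousSubmodule, homogeneousSubmodule_one_eq_span_X] at hp
  induction hp using Submodule.span_induction with
  | mem p hp =>
    obtain ⟨i, rfl⟩ := hp
    simp [eval_dirDeriv, pderiv_X, Pi.single_apply, apply_ite]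
  | zero => simp [eval_dirDeriv]
  | add p q _ _ hp hq =>
    rw [eval_dirDeriv_add, map_add, map_add, map_add, hp.1, hp.2, hq.1, hq.2]
    exact ⟨by ring, rfl⟩
  | smul c p _ hp =>
    obtain ⟨hp1, hp2⟩ := hp
    simp only [eval_dirDeriv, Derivation.map_smul, smul_eval, hp1] at hp2 ⊢
    refine ⟨by ring, ?_⟩
    rw [← hp2, Finset.mul_sum]
    exact Finset.sum_congr rfl fun i _ => by ring

lemma eval_quadratic_expansion {q : MvPolynomial (Fin 5) ℂ} (hq : q.IsHomogeneous 2)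
    (x v : Fin 5 → ℂ) :
    eval (x + v) q = eval x q + eval x (dirDeriv q v) + eval v q ∧
      eval x (dirDeriv q v) = eval v (dirDeriv q x) := by
  rw [← mem_homogeneousSubmodule, ← homogeneousSubmodule_one_pow, pow_two] at hq
  induction hq using Submodule.mul_induction_on' with
  | mem_mul_mem p hp q hq =>
    obtain ⟨hp1, hp2⟩ := eval_linear_expansion hp x v
    obtain ⟨hq1, hq2⟩ := eval_linear_expansion hq x v
    have hp3 := (eval_linear_expansion hp v x).2
    have hq3 := (eval_linear_expansion hq v x).2
    rw [eval_dirDeriv_mul, eval_dirDeriv_mul, map_mul, map_mul, map_mul, hp1, hp2, hp3,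
      hq1, hq2, hq3]
    constructor <;> ring
  | add p _ q _ hp hq =>
    rw [eval_dirDeriv_add, eval_dirDeriv_add, map_add, map_add, map_add, hp.1, hq.1, hp.2, hq.2]
    exact ⟨by ring, rfl⟩

lemma eval_cubic_expansion {E : MvPolynomial (Fin 5) ℂ} (hE : E.IsHomogeneous 3)
    (x v : Fin 5 → ℂ) :
    eval (x + v) E =
      eval x E + eval x (dirDeriv E v) + eval v (dirDeriv E x) + eval v E := by
  rw [← mem_homogeneousSubmodule, ← homogeneousSubmodule_one_pow, pow_succ,
    homogeneousSubmodule_one_pow] at hE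
  induction hE using Submodule.mul_induction_on' with
  | mem_mul_mem q hq p hp =>
    obtain ⟨hp1, hp2⟩ := eval_linear_expansion hp x v
    obtain ⟨hq1, hq2⟩ := eval_quadratic_expansion hq x v
    have hp3 := (eval_linear_expansion hp v x).2
    rw [eval_dirDeriv_mul, eval_dirDeriv_mul, map_mul, map_mul, map_mul, hp1, hp2, hp3,
      hq1, hq2]
    ring
  | add p _ q _ hp hq =>
    rw [eval_dirDeriv_add, eval_dirDeriv_add, map_add, map_add, map_add, hp, hq]
    ring

lemma eval_smul_of_isHomogeneous {p : MvPolynomial (Fin 5) ℂ} {n : ℕ} (hp : p.IsHomogeneous n)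
    (t : ℂ) (x : Fin 5 → ℂ) : eval (t • x) p = t ^ n * eval x p := by
  rw [eval_eq, eval_eq, Finset.mul_sum]
  refine Finset.sum_congr rfl fun d hd => ?_
  have hdn : ∑ i, d i = n := by
    rw [← Finsupp.degree_eq_sum, Finsupp.degree_eq_weight_one]
    exact hp (mem_support_iff.1 hd)
  have hprod : ∏ i ∈ d.support, t ^ d i = t ^ n := by
    rw [Finset.prod_pow_eq_pow_sum, ← hdn, ← Finsupp.degree_eq_sum, Finsupp.degree_apply]
  simp only [Pi.smul_apply, smul_eq_mul, mul_pow, Finset.prod_mul_distrib, hprod]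
  ring

lemma homogeneousComponent_mul_of_isHomogeneous {q : MvPolynomial (Fin 5) ℂ} {n : ℕ}
    (hq : q.IsHomogeneous n) (c : MvPolynomial (Fin 5) ℂ) :
    homogeneousComponent n (c * q) = coeff 0 c • q := by
  conv_lhs => rw [← sum_homogeneousComponent c, Finset.sum_mul, map_sum]
  rw [Finset.sum_eq_single_of_mem 0 (by simp)]
  · rw [homogeneousComponent_zero, homogeneousComponent_C_mul, homogeneousComponent_eq_self hq,
      smul_eq_C_mul]
  · intro j _ hj
    have h := (homogeneousComponent_isHomogeneous j c).mul hq
    rw [homogeneousComponent_of_mem h, if_neg (by omega)]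

lemma J2_eq_range_dirDeriv {E : MvPolynomial (Fin 5) ℂ} (hE : E.IsHomogeneous 3) :
    J2 E = LinearMap.range (dirDeriv E) := by
  apply le_antisymm
  · rintro p ⟨hpJ, hp2⟩
    obtain ⟨c, rfl⟩ := Ideal.mem_span_range_iff_exists_fun.1 hpJ
    refine ⟨fun i => coeff 0 (c i), ?_⟩
    rw [dirDeriv, Fintype.linearCombination_apply, ← homogeneousComponent_eq_self hp2, map_sum]
    exact Finset.sum_congr rfl fun i _ =>
      (homogeneousComponent_mul_of_isHomogeneous hE.pderiv (c i)).symm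
  · rintro _ ⟨v, rfl⟩
    refine ⟨?_, dirDeriv_isHomogeneous hE v⟩
    rw [dirDeriv, Fintype.linearCombination_apply]
    refine Submodule.sum_mem _ fun i _ => Submodule.smul_mem _ _ ?_
    exact Ideal.subset_span ⟨i, rfl⟩

/-- A quadratic form has a nontrivial zero on every two-dimensional subspace. -/
lemma exists_zero_of_isHomogeneous_two {q : MvPolynomial (Fin 5) ℂ} (hq : q.IsHomogeneous 2)
    {l : Submodule ℂ (Fin 5 → ℂ)} (hl : finrank ℂ l = 2) :
    ∃ x ∈ l, x ≠ 0 ∧ eval x q = 0 := by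
  let b := finBasisOfFinrankEq ℂ l hl
  have hb : (b 1 : Fin 5 → ℂ) ≠ 0 := by simpa using b.ne_zero 1
  by_cases h : eval (b 1 : Fin 5 → ℂ) q = 0
  · exact ⟨b 1, (b 1).2, hb, h⟩
  obtain ⟨t, ht⟩ := exists_quadratic_eq_zero (b := eval (b 0 : Fin 5 → ℂ) (dirDeriv q (b 1)))
    (c := eval (b 0 : Fin 5 → ℂ) q) h (IsAlgClosed.exists_eq_mul_self _)
  refine ⟨(b 0 + t • b 1 : l), (b 0 + t • b 1 : l).2, fun h0 => ?_, ?_⟩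
  · have h1 : b 0 + t • b 1 = 0 := Subtype.ext h0
    simpa using congrArg (fun y => b.repr y 0) h1
  · rw [Submodule.coe_add, Submodule.coe_smul, (eval_quadratic_expansion hq _ _).1, map_smul,
      smul_eval, eval_smul_of_isHomogeneous hq, ← ht]
    ring

/-- The linear map sending `v` to the derivative of `E` in the direction `v`, restricted to `l`. -/
def dirDerivOn (E : MvPolynomial (Fin 5) ℂ) (l : Submodule ℂ (Fin 5 → ℂ)) :
    (Fin 5 → ℂ) →ₗ[ℂ] (l → ℂ) :=
  restrictTo l ∘ₗ dirDeriv E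

lemma dirDerivOn_apply (E : MvPolynomial (Fin 5) ℂ) (l : Submodule ℂ (Fin 5 → ℂ))
    (v : Fin 5 → ℂ) (x : l) : dirDerivOn E l v x = eval (x : Fin 5 → ℂ) (dirDeriv E v) := by
  simp [dirDerivOn, restrictTo, aeval_eq_eval]

lemma mem_ker_dirDerivOn {E : MvPolynomial (Fin 5) ℂ} {l : Submodule ℂ (Fin 5 → ℂ)}
    {v : Fin 5 → ℂ} :
    v ∈ LinearMap.ker (dirDerivOn E l) ↔ ∀ x ∈ l, eval x (dirDeriv E v) = 0 := by
  simp [funext_iff, dirDerivOn_apply]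

lemma map_restrictTo_J2 {E : MvPolynomial (Fin 5) ℂ} (hE : E.IsHomogeneous 3)
    (l : Submodule ℂ (Fin 5 → ℂ)) :
    Submodule.map (restrictTo l) (J2 E) = LinearMap.range (dirDerivOn E l) := by
  rw [J2_eq_range_dirDeriv hE, dirDerivOn, LinearMap.range_comp]

lemma two_le_finrank_range_dirDerivOn {E : MvPolynomial (Fin 5) ℂ} (hE : IsSmoothCubic E)
    {l : Submodule ℂ (Fin 5 → ℂ)} (hl : finrank ℂ l = 2) :
    2 ≤ finrank ℂ (LinearMap.range (dirDerivOn E l)) := by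
  by_contra! h
  obtain ⟨⟨_, v, rfl⟩, hw⟩ := finrank_le_one_iff.1 (Nat.le_of_lt_succ h)
  obtain ⟨x, hxl, hx0, hx⟩ := exists_zero_of_isHomogeneous_two (dirDeriv_isHomogeneous hE.1 v) hl
  refine hx0 (hE.2 x fun i => ?_)
  obtain ⟨c, hc⟩ := hw ⟨dirDerivOn E l (Pi.single i 1), _, rfl⟩
  have h1 := congrFun (congrArg Subtype.val hc) ⟨x, hxl⟩
  simpa [dirDerivOn_apply, hx, eval_dirDeriv E (Pi.single i 1), Pi.single_apply] using h1.symm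

lemma le_ker_dirDerivOn {E : MvPolynomial (Fin 5) ℂ} (hE : E.IsHomogeneous 3)
    {l : Submodule ℂ (Fin 5 → ℂ)} (hlV : SubsetV E l) :
    l ≤ LinearMap.ker (dirDerivOn E l) := by
  intro v hv
  rw [mem_ker_dirDerivOn]
  intro x hx
  have h1 := eval_cubic_expansion hE x v
  have h2 := eval_cubic_expansion hE x (-v)
  have h3 := eval_smul_of_isHomogeneous (dirDeriv_isHomogeneous hE x) (-1) v
  rw [neg_one_smul] at h3
  rw [hlV _ (l.add_mem hx hv), hlV x hx, hlV v hv] at h1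
  rw [hlV _ (l.add_mem hx (l.neg_mem hv)), hlV x hx, hlV _ (l.neg_mem hv), map_neg, map_neg,
    h3] at h2
  linear_combination (h2 - h1) / 2

lemma exists_tangent_plane {E : MvPolynomial (Fin 5) ℂ} (hE : E.IsHomogeneous 3)
    {l : Submodule ℂ (Fin 5 → ℂ)} (hl : finrank ℂ l = 2) (hlV : SubsetV E l)
    {v : Fin 5 → ℂ} (hvl : v ∉ l) (hv : v ∈ LinearMap.ker (dirDerivOn E l)) :
    ∃ P : Submodule ℂ (Fin 5 → ℂ), finrank ℂ P = 3 ∧ l ≤ P ∧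
      ∃ h : P →ₗ[ℂ] ℂ, h ≠ 0 ∧ (∀ x : P, (x : Fin 5 → ℂ) ∈ l → h x = 0) ∧
        ∃ g : P →ₗ[ℂ] ℂ, ∀ x : P, eval (x : Fin 5 → ℂ) E = h x * h x * g x := by
  obtain ⟨f, hfv, hfl⟩ := Submodule.exists_le_ker_of_notMem hvl
  let P := l ⊔ Submodule.span ℂ {v}
  have hvP : v ∈ P := Submodule.mem_sup_right (Submodule.mem_span_singleton_self v)
  have hlP : l < P := lt_of_le_of_ne le_sup_left fun h => hvl (h ▸ hvP)
  have hlt := Submodule.finrank_lt_finrank_of_lt hlP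
  have hle := Submodule.finrank_add_le_finrank_add_finrank l (Submodule.span ℂ {v})
  have hsp := finrank_span_singleton (K := ℂ) (v := v) (fun h => hvl (h ▸ l.zero_mem))
  let h : P →ₗ[ℂ] ℂ := (f v)⁻¹ • f ∘ₗ P.subtype
  let ψ : P →ₗ[ℂ] ℂ := (aeval v).toLinearMap ∘ₗ dirDeriv E ∘ₗ P.subtype
  have hP : finrank ℂ P = 3 := by
    change finrank ℂ P ≤ _ at hle
    omega
  refine ⟨P, hP, le_sup_left, h, ?_, ?_, ψ + (eval v E - eval v (dirDeriv E v)) • h, ?_⟩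
  · intro h0
    have h1 := LinearMap.congr_fun h0 ⟨v, hvP⟩
    simp [h, hfv] at h1
  · intro x hx
    have h1 : f x = 0 := hfl hx
    simp [h, h1]
  · rintro ⟨x, hx⟩
    obtain ⟨y, hy, z, hz, rfl⟩ := Submodule.mem_sup.1 hx
    obtain ⟨c, rfl⟩ := Submodule.mem_span_singleton.1 hz
    have hfy : f y = 0 := hfl hy
    have hh : h ⟨y + c • v, hx⟩ = c := by
      simp [h, hfy]
      field_simp
    have hψ : ψ ⟨y + c • v, hx⟩ = eval v (dirDeriv E y) + c * eval v (dirDeriv E v) := by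
      simp [ψ, aeval_eq_eval, smul_eval]
    rw [LinearMap.add_apply, LinearMap.smul_apply (_ - _), hh, hψ, eval_cubic_expansion hE, hlV y hy,
      map_smul, smul_eval, mem_ker_dirDerivOn.1 hv y hy, eval_smul_of_isHomogeneous hE,
      eval_smul_of_isHomogeneous (dirDeriv_isHomogeneous hE y), smul_eq_mul]
    ring

lemma exists_mem_ker_of_tangent_plane {E : MvPolynomial (Fin 5) ℂ} (hE : E.IsHomogeneous 3)
    {l P : Submodule ℂ (Fin 5 → ℂ)} (hlV : SubsetV E l) (hlP : l ≤ P) {h g : P →ₗ[ℂ] ℂ}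
    (h0 : h ≠ 0) (hhl : ∀ x : P, (x : Fin 5 → ℂ) ∈ l → h x = 0)
    (hg : ∀ x : P, eval (x : Fin 5 → ℂ) E = h x * h x * g x) :
    ∃ v ∉ l, v ∈ LinearMap.ker (dirDerivOn E l) := by
  obtain ⟨v, hv⟩ := LinearMap.surjective h0 1
  refine ⟨v, fun hvl => by simp [hhl v hvl] at hv, mem_ker_dirDerivOn.2 fun x hx => ?_⟩
  let y : P := ⟨x, hlP hx⟩
  have hy : h y = 0 := hhl y hx
  have h1 := hg (y + v)
  have h2 := hg (y - v)
  have h3 := hg v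
  have h4 := eval_smul_of_isHomogeneous (dirDeriv_isHomogeneous hE x) (-1) (v : Fin 5 → ℂ)
  have h5 := eval_smul_of_isHomogeneous hE (-1) (v : Fin 5 → ℂ)
  rw [neg_one_smul] at h4 h5
  rw [Submodule.coe_add, eval_cubic_expansion hE, map_add, map_add, hy, hv, hlV x hx] at h1
  rw [Submodule.coe_sub, sub_eq_add_neg, eval_cubic_expansion hE, map_sub, map_sub, hy, hv,
    hlV x hx, map_neg, map_neg, h4, h5] at h2
  rw [hv] at h3
  linear_combination (h1 - h2) / 2 - h3

/-- A line `l ⊆ V` is special (`dim J₂|_l = 2`, a "double line") if and only if there is a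
2-plane `P ⊇ l` tangent to `V` along `l`: the restriction of `E` to `P` is divisible by the
square of a nonzero linear form `h` on `P` vanishing on `l` (the cofactor `g` then being a
linear form on `P`). -/
theorem statement11 (E : MvPolynomial (Fin 5) ℂ) (hE : IsSmoothCubic E)
    (l : Submodule ℂ (Fin 5 → ℂ)) (hl : finrank ℂ l = 2) (hlV : SubsetV E l) :
    finrank ℂ (Submodule.map (restrictTo l) (J2 E)) = 2 ↔
    ∃ P : Submodule ℂ (Fin 5 → ℂ), finrank ℂ P = 3 ∧ l ≤ P ∧
      ∃ h : P →ₗ[ℂ] ℂ, h ≠ 0 ∧ (∀ x : P, (x : Fin 5 → ℂ) ∈ l → h x = 0) ∧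
        ∃ g : P →ₗ[ℂ] ℂ, ∀ x : P, eval (x : Fin 5 → ℂ) E = h x * h x * g x := by
  rw [map_restrictTo_J2 hE.1]
  have hle := le_ker_dirDerivOn hE.1 hlV
  have hrank := LinearMap.finrank_range_add_finrank_ker (dirDerivOn E l)
  rw [finrank_fin_fun] at hrank
  constructor
  · intro h
    obtain ⟨v, hv, hvl⟩ := SetLike.exists_of_lt
      (lt_of_le_of_ne hle fun heq => by rw [← heq] at hrank; omega)
    exact exists_tangent_plane hE.1 hl hlV hvl hv
  · rintro ⟨P, -, hlP, h, h0, hhl, g, hg⟩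
    obtain ⟨v, hvl, hv⟩ := exists_mem_ker_of_tangent_plane hE.1 hlV hlP h0 hhl hg
    have hlt := Submodule.finrank_lt_finrank_of_lt
      (lt_of_le_of_ne hle fun heq => hvl (heq ▸ hv))
    have h2 := two_le_finrank_range_dirDerivOn hE hl
    omega
end
end

section
/- Let E be a smooth homogeneous cubic in S = ℂ[z₀,…,z₄] and let l ⊆ ℂ^5 be a special line (dim_ℂ J_2|_l = 2) not contained in V = {E = 0}, so that the restriction E|_l is a nonzero binary cubic form on l. Then E|_l is either squarefree (three distinct projective zeros on l) or a nonzero scalar multiple of the cube h³ of a linear form h on l; it never has a zero of multiplicity exactly 2. -/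
open MvPolynomial Module

noncomputable section

theorem MvPolynomial.IsHomogeneous.eval_smul {σ R : Type*} [CommSemiring R]
    {p : MvPolynomial σ R} {n : ℕ} (hp : p.IsHomogeneous n) (r : R) (x : σ → R) :
    eval (r • x) p = r ^ n * eval x p := by
  simp only [eval_eq, Finset.mul_sum]
  refine Finset.sum_congr rfl fun d hd => ?_
  have hdeg : ∑ i ∈ d.support, d i = n := by
    simpa [Finsupp.weight_apply, Finsupp.sum] using hp (mem_support_iff.mp hd)
  simp only [Pi.smul_apply, smul_eq_mul, mul_pow, Finset.prod_mul_distrib,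
    Finset.prod_pow_eq_pow_sum, hdeg]
  ring

/-- The directional derivative of a polynomial in terms of its partial derivatives. -/
theorem hasDerivAt_eval_add_smul {σ : Type*} [Fintype σ] (p : MvPolynomial σ ℂ) (v u : σ → ℂ) :
    HasDerivAt (fun s : ℂ => eval (v + s • u) p) (∑ i, u i * eval v (pderiv i p)) 0 := by
  classical
  induction p using MvPolynomial.induction_on with
  | C a => simpa using hasDerivAt_const (0 : ℂ) a
  | add p q hp hq =>
    simpa only [map_add, mul_add, Finset.sum_add_distrib] using hp.fun_add hq
  | mul_X p j hp =>
    have hX : HasDerivAt (fun s : ℂ => v j + s * u j) (u j) 0 := by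
      simpa using ((hasDerivAt_id (0 : ℂ)).mul_const (u j)).const_add (v j)
    have h := hp.fun_mul hX
    simp only [zero_smul, add_zero, zero_mul] at h
    simp only [map_mul, eval_X, Pi.add_apply, Pi.smul_apply, smul_eq_mul]
    refine h.congr_deriv (Eq.symm ?_)
    simp only [Derivation.leibniz, smul_eq_mul, map_add, map_mul, eval_X, mul_add,
      Finset.sum_add_distrib, pderiv_X, Finset.sum_mul]
    rw [add_comm]
    congr 1
    · exact Finset.sum_congr rfl fun i _ => by ring
    · rw [Finset.sum_eq_single j]
      · simp [mul_comm]
      · intro i _ hij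
        simp [Pi.single_eq_of_ne hij.symm]
      · simp

/-- The restriction of a cubic form to a plane is a binary cubic form. -/
theorem MvPolynomial.IsHomogeneous.exists_binary_cubic {σ : Type*} {p : MvPolynomial σ ℂ}
    (hp : p.IsHomogeneous 3) (u v : σ → ℂ) :
    ∃ P : Cubic ℂ, ∀ s t : ℂ, eval (s • u + t • v) p =
      P.a * s ^ 3 + P.b * s ^ 2 * t + P.c * s * t ^ 2 + P.d * t ^ 3 := by
  set q : Polynomial ℂ :=
    MvPolynomial.aeval (fun i => Polynomial.C (u i) * Polynomial.X + Polynomial.C (v i)) p with hq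
  have hdeg : q.natDegree < 4 := by
    refine Nat.lt_succ_of_le ?_
    have := MvPolynomial.aeval_natDegree_le p hp.totalDegree_le
      (fun i => Polynomial.C (u i) * Polynomial.X + Polynomial.C (v i))
      (fun i => Polynomial.natDegree_linear_le)
    simpa using this
  have hqe (s : ℂ) : q.eval s = eval (s • u + v) p := by
    rw [hq, ← Polynomial.coe_evalRingHom, MvPolynomial.aeval_def, MvPolynomial.hom_eval₂,
      MvPolynomial.eval, MvPolynomial.coe_eval₂Hom]
    congr 1
    · refine RingHom.ext fun a => ?_
      simp
    · funext i
      simp [mul_comm s]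
  refine ⟨⟨q.coeff 3, q.coeff 2, q.coeff 1, q.coeff 0⟩, fun s => ?_⟩
  have hc : Continuous fun t : ℂ => eval (s • u + t • v) p :=
    (MvPolynomial.continuous_eval p).comp (by fun_prop)
  refine congrFun (hc.ext_on (dense_compl_singleton (0 : ℂ)) (by fun_prop) fun t ht => ?_)
  have ht : t ≠ 0 := ht
  have hst : s • u + t • v = t • ((s / t) • u + v) := by
    rw [smul_add, smul_smul, mul_div_cancel₀ _ ht]
  simp only [hst, hp.eval_smul, ← hqe, Polynomial.eval_eq_sum_range' hdeg, Finset.sum_range_succ,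
    Finset.sum_range_zero]
  field_simp
  ring

theorem Cubic.exists_roots_factor (P : Cubic ℂ) (ha : P.a ≠ 0) :
    ∃ x y z : ℂ, ∀ s t : ℂ,
      P.a * s ^ 3 + P.b * s ^ 2 * t + P.c * s * t ^ 2 + P.d * t ^ 3 =
        P.a * (s - x * t) * (s - y * t) * (s - z * t) := by
  obtain ⟨x, y, z, h⟩ := (Cubic.splits_iff_roots_eq_three (φ := RingHom.id ℂ) ha).mp
    (IsAlgClosed.splits _)
  have hb := Cubic.b_eq_three_roots ha h
  have hc := Cubic.c_eq_three_roots ha h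
  have hd := Cubic.d_eq_three_roots ha h
  simp only [RingHom.id_apply] at hb hc hd
  refine ⟨x, y, z, fun s t => ?_⟩
  rw [hb, hc, hd]
  ring

theorem pderiv_mem_J2 {E : MvPolynomial (Fin 5) ℂ} (hE : E.IsHomogeneous 3) (i : Fin 5) :
    pderiv i E ∈ J2 E :=
  ⟨Ideal.subset_span ⟨i, rfl⟩, hE.pderiv⟩

/-- The restriction of a smooth cubic to a special line cannot have a zero of multiplicity
exactly 2. -/
theorem IsSmoothCubic.not_double_zero {E : MvPolynomial (Fin 5) ℂ} (hE : IsSmoothCubic E)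
    {l : Submodule ℂ (Fin 5 → ℂ)}
    (hspecial : finrank ℂ (Submodule.map (restrictTo l) (J2 E)) = 2)
    {c : ℂ} (hc : c ≠ 0) {h k : l →ₗ[ℂ] ℂ}
    (hfac : ∀ v : l, eval (v : Fin 5 → ℂ) E = c * h v ^ 2 * k v)
    {u w : l} (hu : h u ≠ 0) (ku : k u = 0) (hw : h w = 0) (kw : k w ≠ 0) : False := by
  set W := Submodule.map (restrictTo l) (J2 E)
  let D (a : l) : MvPolynomial (Fin 5) ℂ := ∑ i, (a : Fin 5 → ℂ) i • pderiv i E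
  have hD (a : l) : D a ∈ J2 E :=
    Submodule.sum_mem _ fun i _ => Submodule.smul_mem _ _ (pderiv_mem_J2 hE.1 i)
  have hDval (a v : l) : restrictTo l (D a) v =
      c * (2 * h v * h a * k v + h v ^ 2 * k a) := by
    have h1 := hasDerivAt_eval_add_smul E (v : Fin 5 → ℂ) a
    have h2 : HasDerivAt (fun s : ℂ => c * (h v + s * h a) ^ 2 * (k v + s * k a))
        (c * (2 * h v * h a * k v + h v ^ 2 * k a)) 0 := by
      have hh : HasDerivAt (fun s : ℂ => h v + s * h a) (h a) 0 := by
        simpa using ((hasDerivAt_id (0 : ℂ)).mul_const (h a)).const_add (h v)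
      have hk : HasDerivAt (fun s : ℂ => k v + s * k a) (k a) 0 := by
        simpa using ((hasDerivAt_id (0 : ℂ)).mul_const (k a)).const_add (k v)
      refine (((hh.fun_pow 2).const_mul c).fun_mul hk).congr_deriv ?_
      simp
      ring
    have h3 : (fun s : ℂ => eval ((v : Fin 5 → ℂ) + s • (a : Fin 5 → ℂ)) E) =
        fun s : ℂ => c * (h v + s * h a) ^ 2 * (k v + s * k a) := by
      funext s
      simpa using hfac (v + s • a)
    rw [h3] at h1
    rw [← h1.unique h2]
    simp [restrictTo, D, aeval_eq_eval]
  have hli : LinearIndependent ℂ ![restrictTo l (D u), restrictTo l (D w)] := by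
    rw [LinearIndependent.pair_iff]
    intro α β hαβ
    have hβ := congrFun hαβ u
    have hα := congrFun hαβ (u + w)
    simp only [Pi.add_apply, Pi.smul_apply, Pi.zero_apply, smul_eq_mul, hDval, map_add, ku, hw,
      mul_zero, zero_add, add_zero, zero_mul] at hβ hα
    have hβ0 : β = 0 := by simpa [hc, hu, kw] using hβ
    subst hβ0
    exact ⟨by simpa [hc, hu, kw] using hα, rfl⟩
  have : FiniteDimensional ℂ W := Module.finite_of_finrank_pos (by omega)
  have hspan : Submodule.span ℂ (Set.range ![restrictTo l (D u), restrictTo l (D w)]) = W := by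
    refine Submodule.eq_of_le_of_finrank_eq ?_ ?_
    · rw [Submodule.span_le]
      rintro _ ⟨i, rfl⟩
      fin_cases i
      exacts [Submodule.mem_map_of_mem (hD u), Submodule.mem_map_of_mem (hD w)]
    · rw [finrank_span_eq_card hli, hspecial, Fintype.card_fin]
  have hzero : (w : Fin 5 → ℂ) = 0 := by
    refine hE.2 _ fun i => ?_
    have hi : restrictTo l (pderiv i E) ∈ W := Submodule.mem_map_of_mem (pderiv_mem_J2 hE.1 i)
    rw [← hspan, Matrix.range_cons, Matrix.range_cons, Matrix.range_empty, Set.union_empty,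
      Set.singleton_union, Submodule.mem_span_pair] at hi
    obtain ⟨α, β, hi⟩ := hi
    have := congrFun hi w
    simp only [Pi.add_apply, Pi.smul_apply, smul_eq_mul, hDval, hw] at this
    simpa [restrictTo, aeval_eq_eval] using this.symm
  have hw0 : w = 0 := Subtype.ext hzero
  exact kw (by rw [hw0, map_zero])

/-- For a special line `l` (`dim J₂|_l = 2`) not contained in `V`, the nonzero binary cubic
`E|_l` either is squarefree — a product of three linear forms with pairwise distinct
(projective) zeros, i.e. pairwise distinct kernels — or is a nonzero scalar multiple of
the cube of a linear form; it never has a zero of multiplicity exactly 2. -/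
theorem statement12 (E : MvPolynomial (Fin 5) ℂ) (hE : IsSmoothCubic E)
    (l : Submodule ℂ (Fin 5 → ℂ)) (hl : finrank ℂ l = 2)
    (hspecial : finrank ℂ (Submodule.map (restrictTo l) (J2 E)) = 2)
    (hnotV : ¬ SubsetV E l) :
    (∃ h₁ h₂ h₃ : l →ₗ[ℂ] ℂ,
        (∀ x : l, eval (x : Fin 5 → ℂ) E = h₁ x * h₂ x * h₃ x) ∧
        LinearMap.ker h₁ ≠ LinearMap.ker h₂ ∧
        LinearMap.ker h₁ ≠ LinearMap.ker h₃ ∧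
        LinearMap.ker h₂ ≠ LinearMap.ker h₃) ∨
    (∃ (c : ℂ) (h : l →ₗ[ℂ] ℂ), c ≠ 0 ∧
        ∀ x : l, eval (x : Fin 5 → ℂ) E = c * (h x) ^ 3) := by
  obtain ⟨e, hel, he⟩ : ∃ e ∈ l, eval e E ≠ 0 := by simpa [SubsetV] using hnotV
  have he0 : (⟨e, hel⟩ : l) ≠ 0 := by
    intro h
    have h0 : e = 0 := congrArg Subtype.val h
    have := hE.1.eval_smul 0 e
    rw [zero_smul, ← h0] at this
    exact he (by simpa using this)
  obtain ⟨f, hf⟩ := exists_linearIndependent_pair_of_one_lt_finrank (R := ℂ) (M := l)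
    (by omega) he0
  let b : Basis (Fin 2) ℂ l := basisOfLinearIndependentOfCardEqFinrank hf (by simp [hl])
  obtain ⟨P, hP⟩ := hE.1.exists_binary_cubic e f
  have ha : P.a ≠ 0 := by
    have := hP 1 0
    simp only [one_smul, zero_smul, add_zero] at this
    rw [this] at he
    simpa using he
  obtain ⟨x, y, z, hxyz⟩ := P.exists_roots_factor ha
  let h (r : ℂ) : l →ₗ[ℂ] ℂ := b.coord 0 - r • b.coord 1
  have hfac (v : l) : eval (v : Fin 5 → ℂ) E = P.a * h x v * h y v * h z v := by
    have hv : (v : Fin 5 → ℂ) = b.repr v 0 • e + b.repr v 1 • (f : Fin 5 → ℂ) := by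
      conv_lhs => rw [← b.sum_repr v]
      simp [b]
    rw [hv, hP, hxyz]
    simp [h]
  let p (r : ℂ) : l := r • b 0 + b 1
  have hp (r s : ℂ) : h r (p s) = s - r := by simp [h, p]
  have hker {r s : ℂ} (hrs : r ≠ s) : LinearMap.ker (h r) ≠ LinearMap.ker (h s) := by
    intro heq
    have hmem : p r ∈ LinearMap.ker (h r) := by simp [hp]
    rw [heq, LinearMap.mem_ker, hp, sub_eq_zero] at hmem
    exact hrs hmem
  have hdouble {r s : ℂ} (hrs : ∀ v : l, eval (v : Fin 5 → ℂ) E = P.a * h r v ^ 2 * h s v) :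
      r = s := by
    by_contra hne
    exact hE.not_double_zero hspecial ha hrs (u := p s) (w := p r)
      (by rw [hp]; exact sub_ne_zero.mpr (Ne.symm hne)) (by simp [hp]) (by simp [hp])
      (by rw [hp]; exact sub_ne_zero.mpr hne)
  by_cases hxy : x = y
  · obtain rfl : x = z := hdouble fun v => by rw [hfac, ← hxy]; ring
    exact Or.inr ⟨P.a, h x, ha, fun v => by rw [hfac, ← hxy]; ring⟩
  by_cases hxz : x = z
  · exact absurd (hdouble fun v => by rw [hfac, ← hxz]; ring) hxy
  by_cases hyz : y = z
  · exact absurd (hdouble (r := y) (s := x) fun v => by rw [hfac, ← hyz]; ring) (Ne.symm hxy)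
  refine Or.inl ⟨P.a • h x, h y, h z, fun v => by simp [hfac], ?_, ?_, hker hyz⟩ <;>
    rw [LinearMap.ker_smul _ _ ha]
  exacts [hker hxy, hker hxz]
end
end

section
/- Suppose E = K(z₁,z₂,z₃) + z₄·Q(z₀,…,z₄) ∈ ℂ[z₀,…,z₄] is a smooth homogeneous cubic, where K is a homogeneous cubic in the variables z₁, z₂, z₃ only and Q is a homogeneous quadric (so that p = (1,0,0,0,0) is a point of V = {E = 0} whose tangent hyperplane is {z₄ = 0}). Then every line l ⊆ ℂ^5 with p ∈ l and l ⊆ {z₄ = 0} is special: dim_ℂ J_2|_l = 2. -/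
open MvPolynomial Module

noncomputable section

theorem MvPolynomial.IsHomogeneous.eval_smul_point {σ R : Type*} [CommSemiring R]
    {φ : MvPolynomial σ R} {n : ℕ} (hφ : φ.IsHomogeneous n) (c : R) (x : σ → R) :
    eval (c • x) φ = c ^ n * eval x φ := by
  rw [eval_eq, eval_eq, Finset.mul_sum]
  refine Finset.sum_congr rfl fun d hd => ?_
  have hdeg : ∑ i ∈ d.support, d i = n := (hφ.degree_eq_sum_deg_support hd).symm
  simp only [Pi.smul_apply, smul_eq_mul, mul_pow, Finset.prod_mul_distrib,
    Finset.prod_pow_eq_pow_sum, hdeg]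
  ring

theorem MvPolynomial.vars_pderiv_subset {σ R : Type*} [CommSemiring R] (i : σ)
    (φ : MvPolynomial σ R) : (pderiv i φ).vars ⊆ φ.vars := by
  classical
  intro k hk
  obtain ⟨m, hm, hkm⟩ := (mem_vars_iff_mem_support k).1 hk
  rw [mem_support_iff, coeff_pderiv] at hm
  refine (mem_vars_iff_mem_support k).2 ⟨m + Finsupp.single i 1,
    mem_support_iff.2 (left_ne_zero_of_mul hm), ?_⟩
  rw [Finsupp.mem_support_iff] at hkm ⊢
  simp only [Finsupp.add_apply]
  omega

theorem MvPolynomial.eval_congr_of_vars {σ R : Type*} [CommSemiring R] {φ : MvPolynomial σ R}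
    {x y : σ → R} (h : ∀ i ∈ φ.vars, x i = y i) : eval x φ = eval y φ :=
  eval₂Hom_congr' rfl (fun i hi _ => h i hi) rfl

/-- A polynomial function without zeros on an affine line over `ℂ` is constant. -/
theorem eval_add_smul_eq_of_forall_ne_zero {σ : Type*} (Q : MvPolynomial σ ℂ) (a b : σ → ℂ)
    (h : ∀ s : ℂ, eval (a + s • b) Q ≠ 0) (s t : ℂ) :
    eval (a + s • b) Q = eval (a + t • b) Q := by
  let f : Polynomial ℂ := aeval (fun i => Polynomial.C (a i) + Polynomial.X * Polynomial.C (b i)) Q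
  have hf : ∀ s, f.eval s = eval (a + s • b) Q := by
    intro s
    have : (Polynomial.aeval s).comp
        (aeval (fun i => Polynomial.C (a i) + Polynomial.X * Polynomial.C (b i))) =
        (aeval (a + s • b) : MvPolynomial σ ℂ →ₐ[ℂ] ℂ) := by
      ext i
      simp
      ring
    have hQ := DFunLike.congr_fun this Q
    rwa [AlgHom.comp_apply, Polynomial.coe_aeval_eq_eval] at hQ
  have hdeg : f.degree = 0 := by
    by_contra hd
    obtain ⟨z, hz⟩ := IsAlgClosed.exists_root f hd
    exact h z ((hf z).symm.trans hz)
  rw [← hf, ← hf, Polynomial.eq_C_of_degree_eq_zero hdeg]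
  simp

/-- A binary form of degree two over `ℂ` has a nontrivial zero. -/
theorem exists_eval_eq_zero_of_isHomogeneous_two {σ : Type*} {Q : MvPolynomial σ ℂ}
    (hQ : Q.IsHomogeneous 2) (a b : σ → ℂ) :
    ∃ s t : ℂ, (s ≠ 0 ∨ t ≠ 0) ∧ eval (s • a + t • b) Q = 0 := by
  by_contra! h
  have hab := eval_add_smul_eq_of_forall_ne_zero Q a b
    (fun s => by simpa using h 1 s (Or.inl one_ne_zero))
  have hba := eval_add_smul_eq_of_forall_ne_zero Q b a
    (fun s => by simpa [add_comm] using h s 1 (Or.inr one_ne_zero))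
  have hne : eval (b + (1 : ℂ) • a) Q ≠ 0 := by
    simpa [add_comm] using h 1 1 (Or.inl one_ne_zero)
  have h2 : eval (a + (2 : ℂ) • b) Q = 2 ^ 2 * eval (b + (1 / 2 : ℂ) • a) Q := by
    rw [← hQ.eval_smul_point]
    congr 2
    ext i
    simp
    ring
  have h1 : eval (a + (1 : ℂ) • b) Q = eval (b + (1 : ℂ) • a) Q := by
    simp [add_comm]
  rw [hab 2 1, hba (1 / 2) 1, h1] at h2
  apply hne
  linear_combination -(1 / 3) * h2

/-- A homogeneous element of an ideal generated by forms of the same degree is a combination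
of these forms with constant coefficients. -/
theorem mem_span_range_of_isHomogeneous {σ R ι : Type*} [CommRing R] [Fintype ι] {n : ℕ}
    {d : ι → MvPolynomial σ R} (hd : ∀ i, (d i).IsHomogeneous n) {f : MvPolynomial σ R}
    (hf : f.IsHomogeneous n) (hmem : f ∈ Ideal.span (Set.range d)) :
    f ∈ Submodule.span R (Set.range d) := by
  classical
  let _ : GradedAlgebra (homogeneousSubmodule σ R) := MvPolynomial.gradedAlgebra
  obtain ⟨g, rfl⟩ := Ideal.mem_span_range_iff_exists_fun.1 hmem
  have hg : ∀ i, homogeneousComponent n (g i * d i) = coeff 0 (g i) • d i := by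
    intro i
    have := DirectSum.coe_decompose_mul_of_right_mem_of_le (homogeneousSubmodule σ R)
      (a := g i) (b := d i) (i := n) (n := n) (hd i) le_rfl
    rw [Nat.sub_self] at this
    have h0 : (DirectSum.decompose (homogeneousSubmodule σ R) (g i) 0 : MvPolynomial σ R) =
        homogeneousComponent 0 (g i) := decomposition.decompose'_apply _ _
    rw [h0, homogeneousComponent_zero, ← smul_eq_C_mul] at this
    exact (decomposition.decompose'_apply _ _).symm.trans this
  have hself := homogeneousComponent_of_mem (m := n) hf
  rw [if_pos rfl] at hself
  rw [← hself, map_sum]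
  refine Submodule.sum_mem _ fun i _ => ?_
  rw [hg]
  exact Submodule.smul_mem _ _ (Submodule.subset_span ⟨i, rfl⟩)

theorem J2_eq_span {E : MvPolynomial (Fin 5) ℂ} (hE : E.IsHomogeneous 3) :
    J2 E = Submodule.span ℂ (Set.range fun i => pderiv i E) := by
  apply le_antisymm
  · rintro f ⟨hJ, h2⟩
    exact mem_span_range_of_isHomogeneous (fun i => hE.pderiv) h2 hJ
  · rw [Submodule.span_le]
    rintro _ ⟨i, rfl⟩
    exact ⟨Ideal.subset_span ⟨i, rfl⟩, hE.pderiv⟩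

/-- A plane in `F^σ` containing `p` is spanned by `p` and a vector `v` whose coordinate `k`
vanishes and which is normalized at some other coordinate. -/
theorem exists_coordinate_of_finrank_eq_two {σ F : Type*} [Finite σ] [DecidableEq σ] [Field F]
    (l : Submodule F (σ → F)) (hl : finrank F l = 2) (k : σ)
    (hp : Pi.single k (1 : F) ∈ l) :
    ∃ j, j ≠ k ∧ ∃ v ∈ l, v k = 0 ∧ v j = 1 ∧
      ∀ x ∈ l, x = x k • Pi.single k (1 : F) + x j • v := by
  set p : σ → F := Pi.single k 1 with hpdef
  have hpk : p k = 1 := by simp [hpdef]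
  have hp0 : p ≠ 0 := fun h => by simp [h] at hpk
  have hlt : Submodule.span F {p} < l := by
    refine lt_of_le_of_ne ((Submodule.span_singleton_le_iff_mem _ _).2 hp) fun h => ?_
    rw [← h, finrank_span_singleton hp0] at hl
    omega
  obtain ⟨w, hw, hwp⟩ := SetLike.exists_of_lt hlt
  have hu : w - w k • p ≠ 0 := fun h =>
    hwp (Submodule.mem_span_singleton.2 ⟨w k, (sub_eq_zero.1 h).symm⟩)
  obtain ⟨j, hj⟩ := Function.ne_iff.1 hu
  have hul : w - w k • p ∈ l := l.sub_mem hw (l.smul_mem _ hp)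
  have huk : (w - w k • p) k = 0 := by simp [hpk]
  generalize w - w k • p = u at hu hj hul huk
  have hjk : j ≠ k := fun h => hj (by rw [h, huk]; rfl)
  have hpj : p j = 0 := by simp [hpdef, hjk]
  have hvj : ((u j)⁻¹ • u) j = 1 := by simpa using inv_mul_cancel₀ hj
  have hvk : ((u j)⁻¹ • u) k = 0 := by simp [huk]
  have hvl : (u j)⁻¹ • u ∈ l := l.smul_mem _ hul
  generalize (u j)⁻¹ • u = v at hvj hvk hvl
  refine ⟨j, hjk, v, hvl, hvk, hvj, fun x hx => ?_⟩
  have hli : LinearIndependent F ![p, v] := by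
    rw [LinearIndependent.pair_iff]
    intro s t h
    have hk := congrFun h k
    have hjt := congrFun h j
    simp [hpk, hpj, hvk, hvj] at hk hjt
    exact ⟨hk, hjt⟩
  have hspan : Submodule.span F {p, v} = l := by
    refine Submodule.eq_of_le_of_finrank_eq ?_ ?_
    · rw [Submodule.span_le]
      rintro y (rfl | rfl)
      exacts [hp, hvl]
    · rw [hl, ← Matrix.range_cons_cons_empty p v ![], finrank_span_eq_card hli, Fintype.card_fin]
  rw [← hspan, Submodule.mem_span_pair] at hx
  obtain ⟨a, b, rfl⟩ := hx
  simp [hpk, hpj, hvk, hvj]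

/-- Suppose `E = K(z₁,z₂,z₃) + z₄·Q` is a smooth cubic, so that `p = (1,0,0,0,0)` is a
point of `V = {E = 0}` with tangent hyperplane `{z₄ = 0}`.  Then every line through `p`
contained in `{z₄ = 0}` is special: `dim J₂|_l = 2`. -/
theorem statement13 (K Q : MvPolynomial (Fin 5) ℂ)
    (hK : K.IsHomogeneous 3) (hKvars : K.vars ⊆ ({1, 2, 3} : Finset (Fin 5)))
    (hQ : Q.IsHomogeneous 2)
    (hsm : IsSmoothCubic (K + X 4 * Q))
    (l : Submodule ℂ (Fin 5 → ℂ)) (hl : finrank ℂ l = 2)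
    (hp : (fun i => if i = 0 then (1 : ℂ) else 0) ∈ l)
    (hl4 : ∀ x ∈ l, x 4 = 0) :
    finrank ℂ (Submodule.map (restrictTo l) (J2 (K + X 4 * Q))) = 2 := by
  have hE := hsm.1
  have hpe : (fun i => if i = 0 then (1 : ℂ) else 0) = (Pi.single 0 1 : Fin 5 → ℂ) := by
    ext i
    simp [Pi.single_apply]
  rw [hpe] at hp
  obtain ⟨j, hj0, v, hvl, hv0, hvj, hdec⟩ := exists_coordinate_of_finrank_eq_two l hl 0 hp
  set p : Fin 5 → ℂ := Pi.single 0 1 with hpdef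
  have hpj : p j = 0 := by simp [hpdef, hj0]
  have hp0 : p 0 = 1 := by simp [hpdef]
  have hK4 : pderiv 4 K = 0 :=
    pderiv_eq_zero_of_notMem_vars fun h => by simpa using hKvars h
  have hKx : ∀ x ∈ l, ∀ i, eval x (pderiv i K) = (x j) ^ 2 * eval v (pderiv i K) := by
    intro x hx i
    rw [← (hK.pderiv (i := i)).eval_smul_point]
    refine eval_congr_of_vars fun k hk => ?_
    have hk0 : k ≠ 0 := by
      rintro rfl
      simpa using hKvars (vars_pderiv_subset i K hk)
    have := congrFun (hdec x hx) k
    simpa [hpdef, hk0] using this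
  have hD : ∀ x ∈ l, ∀ i, i ≠ 4 →
      eval x (pderiv i (K + X 4 * Q)) = (x j) ^ 2 * eval v (pderiv i K) := by
    intro x hx i hi
    rw [map_add, pderiv_mul, pderiv_X_of_ne hi.symm, ← hKx x hx i]
    simp [hl4 x hx]
  have hD4 : ∀ x ∈ l, eval x (pderiv 4 (K + X 4 * Q)) = eval x Q := by
    intro x hx
    rw [map_add, pderiv_mul, pderiv_X_self, hK4]
    simp [hl4 x hx]
  -- the smoothness of the cubic at `p`
  have hQp : eval p Q ≠ 0 := by
    intro h
    have hz := hsm.2 p fun i => by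
      by_cases hi : i = 4
      · rw [hi, hD4 p hp, h]
      · rw [hD p hp i hi, hpj]
        ring
    simp [hz] at hp0
  -- the smoothness of the cubic at a zero of `Q` on the line
  obtain ⟨i₀, hi₀, hne⟩ : ∃ i, i ≠ 4 ∧ eval v (pderiv i K) ≠ 0 := by
    by_contra! h
    obtain ⟨s, t, hst, hz⟩ := exists_eval_eq_zero_of_isHomogeneous_two hQ p v
    have hmem : s • p + t • v ∈ l := l.add_mem (l.smul_mem _ hp) (l.smul_mem _ hvl)
    have hx := hsm.2 (s • p + t • v) fun i => by
      by_cases hi : i = 4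
      · rw [hi, hD4 _ hmem, hz]
      · rw [hD _ hmem i hi, h i hi, mul_zero]
    have h0 := congrFun hx 0
    have hj := congrFun hx j
    simp [hp0, hv0, hpj, hvj] at h0 hj
    rcases hst with hs | ht
    exacts [hs h0, ht hj]
  let f : l → ℂ := fun x => (x : Fin 5 → ℂ) j ^ 2
  let q : l → ℂ := fun x => eval (x : Fin 5 → ℂ) Q
  have hR : ∀ i, i ≠ 4 →
      restrictTo l (pderiv i (K + X 4 * Q)) = eval v (pderiv i K) • f := by
    intro i hi
    ext x
    refine (hD x x.2 i hi).trans ?_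
    simp [f, mul_comm]
  have hR4 : restrictTo l (pderiv 4 (K + X 4 * Q)) = q := by
    ext x
    exact hD4 x x.2
  have hspan : Submodule.map (restrictTo l) (J2 (K + X 4 * Q)) =
      Submodule.span ℂ (Set.range ![f, q]) := by
    rw [J2_eq_span hE, Submodule.map_span]
    apply le_antisymm
    · rw [Submodule.span_le]
      rintro _ ⟨_, ⟨i, rfl⟩, rfl⟩
      by_cases hi : i = 4
      · subst hi
        exact Submodule.subset_span ⟨1, hR4.symm⟩
      · simp only [hR i hi]
        exact Submodule.smul_mem _ _ (Submodule.subset_span ⟨0, rfl⟩)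
    · rw [Submodule.span_le]
      rintro _ ⟨m, rfl⟩
      fin_cases m
      · have : f = (eval v (pderiv i₀ K))⁻¹ • restrictTo l (pderiv i₀ (K + X 4 * Q)) := by
          rw [hR i₀ hi₀, smul_smul, inv_mul_cancel₀ hne, one_smul]
        change f ∈ _
        rw [this]
        exact Submodule.smul_mem _ _ (Submodule.subset_span ⟨_, ⟨i₀, rfl⟩, rfl⟩)
      · exact Submodule.subset_span ⟨_, ⟨4, rfl⟩, hR4⟩
  have hli : LinearIndependent ℂ ![f, q] := by
    rw [LinearIndependent.pair_iff]
    intro s t h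
    have h1 := congrFun h ⟨p, hp⟩
    have h2 := congrFun h ⟨v, hvl⟩
    simp [f, q, hpj, hvj, hQp] at h1 h2
    subst h1
    simpa using h2
  rw [hspan, finrank_span_eq_card hli, Fintype.card_fin]
end
end

section
/- Let Q₀, Q₁ ∈ ℂ[z₀,…,z₄] be homogeneous quadrics such that the cubic E₀ = z₀·Q₀ + z₁·Q₁ + z₂²·z₃ is smooth. Then for every homogeneous cubic G ∈ S^3 there exist homogeneous quadrics A₀, A₁ ∈ S^2 and linear forms L₀, L₁, L₂, L₃ ∈ S^1 such that G = z₀·A₀ + L₀·Q₀ + z₁·A₁ + L₁·Q₁ + z₂²·L₃ + z₂·z₃·L₂. -/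
open MvPolynomial Module

noncomputable section

/-- A form of positive degree is a combination of the variables with coefficients forms of one
degree less. -/
lemma MvPolynomial.IsHomogeneous.exists_eq_sum_X_mul {σ K : Type*} [Fintype σ] [Field K]
    [CharZero K] {n : ℕ} {φ : MvPolynomial σ K} (h : φ.IsHomogeneous (n + 1)) :
    ∃ A : σ → MvPolynomial σ K, (∀ i, (A i).IsHomogeneous n) ∧ φ = ∑ i, X i * A i := by
  refine ⟨fun i => C ((n + 1 : K)⁻¹) * pderiv i φ, fun i => ?_, ?_⟩
  · simpa only [zero_add, Nat.add_sub_cancel] using (isHomogeneous_C σ ((n + 1 : K)⁻¹)).mul (h.pderiv (i := i))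
  · have hn : (n + 1 : K) ≠ 0 := by exact_mod_cast n.succ_ne_zero
    have e := h.sum_X_mul_pderiv
    rw [Finset.sum_congr rfl fun i _ => mul_left_comm (X i) (C _) (pderiv i φ), ← Finset.mul_sum,
      e, nsmul_eq_mul, ← mul_assoc, ← map_natCast (C (σ := σ) (R := K)), ← map_mul]
    simp [hn]

/-- A linear form is a combination of the variables with constant coefficients. -/
lemma MvPolynomial.IsHomogeneous.exists_eq_sum_X_mul_C {σ K : Type*} [Fintype σ] [Field K]
    [CharZero K] {φ : MvPolynomial σ K} (h : φ.IsHomogeneous 1) :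
    ∃ a : σ → K, φ = ∑ i, X i * C (a i) := by
  obtain ⟨A, hA, e⟩ := h.exists_eq_sum_X_mul
  refine ⟨fun i => (A i).coeff 0, e.trans (Finset.sum_congr rfl fun i _ => ?_)⟩
  rw [← totalDegree_eq_zero_iff_eq_C.1 ((totalDegree_zero_iff_isHomogeneous σ).2 (hA i))]

/-- A quadric in five variables, expanded modulo the first three variables. -/
lemma MvPolynomial.IsHomogeneous.exists_quadric_expansion {Q : MvPolynomial (Fin 5) ℂ}
    (h : Q.IsHomogeneous 2) :
    ∃ (p q r : ℂ) (A B l : MvPolynomial (Fin 5) ℂ) (u v w : ℂ),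
      A.IsHomogeneous 1 ∧ B.IsHomogeneous 1 ∧ l.IsHomogeneous 1 ∧
      l = C u * X 2 + C v * X 3 + C w * X 4 ∧
      Q = C p * X 3 ^ 2 + C q * (X 3 * X 4) + C r * X 4 ^ 2 + X 0 * A + X 1 * B + X 2 * l := by
  obtain ⟨A, hA, e⟩ := h.exists_eq_sum_X_mul
  choose a ha using fun i => (hA i).exists_eq_sum_X_mul_C
  have hl (i : Fin 5) (t : ℂ) : (C t * X i : MvPolynomial (Fin 5) ℂ).IsHomogeneous 1 := by
    simpa using (isHomogeneous_C (Fin 5) t).mul (isHomogeneous_X ℂ i)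
  refine ⟨a 3 3, a 3 4 + a 4 3, a 4 4,
    A 0 + C (a 2 0) * X 2 + C (a 3 0) * X 3 + C (a 4 0) * X 4,
    A 1 + C (a 2 1) * X 2 + C (a 3 1) * X 3 + C (a 4 1) * X 4,
    _, a 2 2, a 2 3 + a 3 2, a 2 4 + a 4 2, ?_, ?_, ?_, rfl, ?_⟩
  · exact (((hA 0).add (hl _ _)).add (hl _ _)).add (hl _ _)
  · exact (((hA 1).add (hl _ _)).add (hl _ _)).add (hl _ _)
  · exact ((hl _ _).add (hl _ _)).add (hl _ _)
  · rw [e, Fin.sum_univ_five, ha 2, ha 3, ha 4]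
    simp only [Fin.sum_univ_five, C_add]
    ring

/-- Two binary quadratic forms over `ℂ` with vanishing resultant have a common nontrivial zero. -/
lemma exists_common_zero_of_resultant_eq_zero {p q r p' q' r' : ℂ}
    (h : (p * r' - p' * r) ^ 2 = (p * q' - p' * q) * (q * r' - q' * r)) :
    ∃ b c : ℂ, (b ≠ 0 ∨ c ≠ 0) ∧ p * b ^ 2 + q * (b * c) + r * c ^ 2 = 0 ∧
      p' * b ^ 2 + q' * (b * c) + r' * c ^ 2 = 0 := by
  by_cases hD : p * r' - p' * r = 0 ∧ p * q' - p' * q = 0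
  · obtain ⟨h2, h1⟩ := hD
    have root (x y z : ℂ) (hx : x ≠ 0) : ∃ b, x * (b * b) + y * b + z = 0 := by
      obtain ⟨s, hs⟩ := IsAlgClosed.exists_eq_mul_self (discrim x y z)
      exact exists_quadratic_eq_zero hx ⟨s, hs⟩
    by_cases hp : p = 0
    · by_cases hp' : p' = 0
      · exact ⟨1, 0, by simp [hp, hp']⟩
      · obtain ⟨b, hb⟩ := root p' q' r' hp'
        refine ⟨b, 1, by simp, mul_left_cancel₀ hp' ?_, by linear_combination hb⟩
        linear_combination p * hb - b * h1 - h2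
    · obtain ⟨b, hb⟩ := root p q r hp
      refine ⟨b, 1, by simp, by linear_combination hb, mul_left_cancel₀ hp ?_⟩
      linear_combination p' * hb + b * h1 + h2
  · refine ⟨p * r' - p' * r, -(p * q' - p' * q), ?_, ?_, ?_⟩
    · rw [neg_ne_zero]
      tauto
    · linear_combination p * h
    · linear_combination p' * h

/-- The image of the differential `(A₀, A₁, L₀, L₁, L₂, L₃) ↦
z₀A₀ + L₀Q₀ + z₁A₁ + L₁Q₁ + z₂²L₃ + z₂z₃L₂`. -/
def differentialRange (Q₀ Q₁ : MvPolynomial (Fin 5) ℂ) :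
    Submodule ℂ (MvPolynomial (Fin 5) ℂ) where
  carrier := {G | ∃ A₀ A₁ L₀ L₁ L₂ L₃ : MvPolynomial (Fin 5) ℂ,
      A₀.IsHomogeneous 2 ∧ A₁.IsHomogeneous 2 ∧
      L₀.IsHomogeneous 1 ∧ L₁.IsHomogeneous 1 ∧ L₂.IsHomogeneous 1 ∧ L₃.IsHomogeneous 1 ∧
      G = X 0 * A₀ + L₀ * Q₀ + X 1 * A₁ + L₁ * Q₁ + X 2 ^ 2 * L₃ + X 2 * X 3 * L₂}
  zero_mem' := ⟨0, 0, 0, 0, 0, 0, isHomogeneous_zero _ _ _, isHomogeneous_zero _ _ _,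
    isHomogeneous_zero _ _ _, isHomogeneous_zero _ _ _, isHomogeneous_zero _ _ _,
    isHomogeneous_zero _ _ _, by simp⟩
  add_mem' := by
    rintro _ _ ⟨A, B, K, L, M, N, hA, hB, hK, hL, hM, hN, rfl⟩
      ⟨A', B', K', L', M', N', hA', hB', hK', hL', hM', hN', rfl⟩
    exact ⟨_, _, _, _, _, _, hA.add hA', hB.add hB', hK.add hK', hL.add hL', hM.add hM',
      hN.add hN', by ring⟩
  smul_mem' := by
    rintro t _ ⟨A, B, K, L, M, N, hA, hB, hK, hL, hM, hN, rfl⟩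
    have hs {n : ℕ} {φ : MvPolynomial (Fin 5) ℂ} (h : φ.IsHomogeneous n) :
        (C t * φ).IsHomogeneous n := by
      simpa using (isHomogeneous_C (Fin 5) t).mul h
    exact ⟨_, _, _, _, _, _, hs hA, hs hB, hs hK, hs hL, hs hM, hs hN, by
      rw [smul_eq_C_mul]; ring⟩

/-- A subspace containing the products of the variables `z₃, z₄` with two binary quadratic forms
of nonzero resultant contains all binary cubics in `z₃, z₄`. -/
lemma binary_cubic_mem_of_resultant_ne_zero (W : Submodule ℂ (MvPolynomial (Fin 5) ℂ))
    {p q r p' q' r' : ℂ}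
    (hres : (p * r' - p' * r) ^ 2 - (p * q' - p' * q) * (q * r' - q' * r) ≠ 0)
    (f3 : X 3 * (C p * X 3 ^ 2 + C q * (X 3 * X 4) + C r * X 4 ^ 2) ∈ W)
    (f4 : X 4 * (C p * X 3 ^ 2 + C q * (X 3 * X 4) + C r * X 4 ^ 2) ∈ W)
    (f3' : X 3 * (C p' * X 3 ^ 2 + C q' * (X 3 * X 4) + C r' * X 4 ^ 2) ∈ W)
    (f4' : X 4 * (C p' * X 3 ^ 2 + C q' * (X 3 * X 4) + C r' * X 4 ^ 2) ∈ W) :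
    X 3 ^ 3 ∈ W ∧ X 3 ^ 2 * X 4 ∈ W ∧ X 3 * X 4 ^ 2 ∈ W ∧ X 4 ^ 3 ∈ W := by
  have memC (t : ℂ) {φ} (h : φ ∈ W) : C t * φ ∈ W := by
    simpa only [smul_eq_C_mul] using W.smul_mem t h
  have cancelC {t : ℂ} (ht : t ≠ 0) {φ} (h : C t * φ ∈ W) : φ ∈ W := by
    rwa [← smul_eq_C_mul, Submodule.smul_mem_iff _ ht] at h
  have hp : p ≠ 0 ∨ p' ≠ 0 := by
    by_contra! h
    simp [h.1, h.2] at hres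
  have hr : r ≠ 0 ∨ r' ≠ 0 := by
    by_contra! h
    simp [h.1, h.2] at hres
  have hU : C (p * q' - p' * q) * (X 3 ^ 2 * X 4) + C (p * r' - p' * r) * (X 3 * X 4 ^ 2) ∈
      W := by
    convert sub_mem (memC p f3') (memC p' f3) using 1
    simp only [C_sub, C_mul]
    ring
  have hV : C (p * r' - p' * r) * (X 3 ^ 2 * X 4) + C (q * r' - q' * r) * (X 3 * X 4 ^ 2) ∈
      W := by
    convert sub_mem (memC r' f4) (memC r f4') using 1
    simp only [C_sub, C_mul]
    ring
  have mem334 : X 3 ^ 2 * X 4 ∈ W := by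
    refine cancelC hres ?_
    convert sub_mem (memC (p * r' - p' * r) hV) (memC (q * r' - q' * r) hU) using 1
    simp only [C_sub, C_mul, C_pow]
    ring
  have mem344 : X 3 * X 4 ^ 2 ∈ W := by
    refine cancelC hres ?_
    convert sub_mem (memC (p * r' - p' * r) hU) (memC (p * q' - p' * q) hV) using 1
    simp only [C_sub, C_mul, C_pow]
    ring
  have mem333 : X 3 ^ 3 ∈ W := by
    rcases hp with h | h <;> refine cancelC h ?_
    · convert sub_mem (sub_mem f3 (memC q mem334)) (memC r mem344) using 1
      ring
    · convert sub_mem (sub_mem f3' (memC q' mem334)) (memC r' mem344) using 1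
      ring
  have mem444 : X 4 ^ 3 ∈ W := by
    rcases hr with h | h <;> refine cancelC h ?_
    · convert sub_mem (sub_mem f4 (memC q mem344)) (memC p mem334) using 1
      ring
    · convert sub_mem (sub_mem f4' (memC q' mem344)) (memC p' mem334) using 1
      ring
  exact ⟨mem333, mem334, mem344, mem444⟩

/-- A subspace containing suitable multiples of `z₂²`, `z₂z₃` and the monomial `z₂z₄²` contains the
products of `z₃z₂` and `z₄z₂` with the linear forms in `z₂, z₃, z₄`. -/
lemma X_mul_X_two_mul_mem (W : Submodule ℂ (MvPolynomial (Fin 5) ℂ))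
    (mem22 : ∀ {L}, L.IsHomogeneous 1 → X 2 ^ 2 * L ∈ W)
    (mem23 : ∀ {L}, L.IsHomogeneous 1 → X 2 * X 3 * L ∈ W)
    (mem244 : X 2 * X 4 ^ 2 ∈ W) (i : Fin 5) (hi : i = 3 ∨ i = 4) (u v w : ℂ) :
    X i * (X 2 * (C u * X 2 + C v * X 3 + C w * X 4)) ∈ W := by
  have x (i : Fin 5) : (X i : MvPolynomial (Fin 5) ℂ).IsHomogeneous 1 := isHomogeneous_X ℂ i
  have memC (t : ℂ) {φ} (h : φ ∈ W) : C t * φ ∈ W := by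
    simpa only [smul_eq_C_mul] using W.smul_mem t h
  have e : X i * (X 2 * (C u * X 2 + C v * X 3 + C w * X 4)) =
      C u * (X 2 ^ 2 * X i) + C v * (X 2 * X 3 * X i) + C w * (X 2 * X 4 * X i) := by ring
  rw [e]
  refine add_mem (add_mem (memC _ (mem22 (x i))) (memC _ (mem23 (x i)))) (memC _ ?_)
  rcases hi with rfl | rfl
  · rw [mul_right_comm]
    exact mem23 (x 4)
  · rwa [mul_assoc, ← sq]

/-- A subspace containing suitable generators contains every cubic. -/
lemma cubic_mem_of_generators_mem (W : Submodule ℂ (MvPolynomial (Fin 5) ℂ))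
    (memX0 : ∀ {A}, A.IsHomogeneous 2 → X 0 * A ∈ W)
    (memX1 : ∀ {A}, A.IsHomogeneous 2 → X 1 * A ∈ W)
    (mem22 : ∀ {L}, L.IsHomogeneous 1 → X 2 ^ 2 * L ∈ W)
    (mem23 : ∀ {L}, L.IsHomogeneous 1 → X 2 * X 3 * L ∈ W)
    (mem244 : X 2 * X 4 ^ 2 ∈ W) (mem333 : X 3 ^ 3 ∈ W) (mem334 : X 3 ^ 2 * X 4 ∈ W)
    (mem344 : X 3 * X 4 ^ 2 ∈ W) (mem444 : X 4 ^ 3 ∈ W)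
    {G : MvPolynomial (Fin 5) ℂ} (hG : G.IsHomogeneous 3) : G ∈ W := by
  have x (i : Fin 5) : (X i : MvPolynomial (Fin 5) ℂ).IsHomogeneous 1 := isHomogeneous_X ℂ i
  have memC (t : ℂ) {φ} (h : φ ∈ W) : C t * φ ∈ W := by
    simpa only [smul_eq_C_mul] using W.smul_mem t h
  obtain ⟨H, hH, rfl⟩ := hG.exists_eq_sum_X_mul
  have red (i : Fin 5) (h33 : X i * X 3 ^ 2 ∈ W) (h34 : X i * (X 3 * X 4) ∈ W)
      (h44 : X i * X 4 ^ 2 ∈ W)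
      (h2 : ∀ u v w : ℂ,
        (C u * X 2 + C v * X 3 + C w * X 4 : MvPolynomial (Fin 5) ℂ).IsHomogeneous 1 →
        X i * (X 2 * (C u * X 2 + C v * X 3 + C w * X 4)) ∈ W) :
      X i * H i ∈ W := by
    obtain ⟨s, t, m, D, E, k, a, b, c, hD, hE, hk, rfl, eH⟩ := (hH i).exists_quadric_expansion
    have e : X i * H i = C s * (X i * X 3 ^ 2) + C t * (X i * (X 3 * X 4)) +
        C m * (X i * X 4 ^ 2) + X 0 * (X i * D) + X 1 * (X i * E) +
        X i * (X 2 * (C a * X 2 + C b * X 3 + C c * X 4)) := by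
      rw [eH]; ring
    rw [e]
    exact add_mem (add_mem (add_mem (add_mem (add_mem (memC _ h33) (memC _ h34)) (memC _ h44))
      (memX0 ((x i).mul hD))) (memX1 ((x i).mul hE))) (h2 a b c hk)
  rw [Fin.sum_univ_five]
  refine add_mem (add_mem (add_mem (add_mem (memX0 (hH 0)) (memX1 (hH 1)))
    (red 2 ?_ ?_ mem244 ?_))
    (red 3 ?_ ?_ mem344 fun u v w _ =>
      X_mul_X_two_mul_mem W mem22 mem23 mem244 3 (.inl rfl) u v w))
    (red 4 ?_ ?_ ?_ fun u v w _ =>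
      X_mul_X_two_mul_mem W mem22 mem23 mem244 4 (.inr rfl) u v w)
  · rw [sq, ← mul_assoc]
    exact mem23 (x 3)
  · rw [← mul_assoc]
    exact mem23 (x 4)
  · intro u v w hl
    rw [← mul_assoc, ← sq]
    exact mem22 hl
  · convert mem333 using 1
    ring
  · convert mem334 using 1
    ring
  · convert mem334 using 1
    ring
  · convert mem344 using 1
    ring
  · convert mem444 using 1
    ring

/-- Surjectivity of the differential `dΦ` at the cubic `E₀ = z₀Q₀ + z₁Q₁ + z₂²z₃` with a
marked double line: every cubic `G` can be written as
`z₀A₀ + L₀Q₀ + z₁A₁ + L₁Q₁ + z₂²L₃ + z₂z₃L₂`. -/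
theorem statement15 (Q₀ Q₁ : MvPolynomial (Fin 5) ℂ)
    (hQ₀ : Q₀.IsHomogeneous 2) (hQ₁ : Q₁.IsHomogeneous 2)
    (hsm : IsSmoothCubic (X 0 * Q₀ + X 1 * Q₁ + X 2 ^ 2 * X 3))
    (G : MvPolynomial (Fin 5) ℂ) (hG : G.IsHomogeneous 3) :
    ∃ A₀ A₁ L₀ L₁ L₂ L₃ : MvPolynomial (Fin 5) ℂ,
      A₀.IsHomogeneous 2 ∧ A₁.IsHomogeneous 2 ∧
      L₀.IsHomogeneous 1 ∧ L₁.IsHomogeneous 1 ∧ L₂.IsHomogeneous 1 ∧ L₃.IsHomogeneous 1 ∧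
      G = X 0 * A₀ + L₀ * Q₀ + X 1 * A₁ + L₁ * Q₁ + X 2 ^ 2 * L₃ + X 2 * X 3 * L₂ := by
  change G ∈ differentialRange Q₀ Q₁
  have z (n : ℕ) : (0 : MvPolynomial (Fin 5) ℂ).IsHomogeneous n := isHomogeneous_zero _ _ _
  have x (i : Fin 5) : (X i : MvPolynomial (Fin 5) ℂ).IsHomogeneous 1 := isHomogeneous_X ℂ i
  have memX0 {A} (h : A.IsHomogeneous 2) : X 0 * A ∈ differentialRange Q₀ Q₁ :=
    ⟨A, 0, 0, 0, 0, 0, h, z _, z _, z _, z _, z _, by ring⟩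
  have memX1 {A} (h : A.IsHomogeneous 2) : X 1 * A ∈ differentialRange Q₀ Q₁ :=
    ⟨0, A, 0, 0, 0, 0, z _, h, z _, z _, z _, z _, by ring⟩
  have memQ0 {L} (h : L.IsHomogeneous 1) : L * Q₀ ∈ differentialRange Q₀ Q₁ :=
    ⟨0, 0, L, 0, 0, 0, z _, z _, h, z _, z _, z _, by ring⟩
  have memQ1 {L} (h : L.IsHomogeneous 1) : L * Q₁ ∈ differentialRange Q₀ Q₁ :=
    ⟨0, 0, 0, L, 0, 0, z _, z _, z _, h, z _, z _, by ring⟩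
  have mem23 {L} (h : L.IsHomogeneous 1) : X 2 * X 3 * L ∈ differentialRange Q₀ Q₁ :=
    ⟨0, 0, 0, 0, L, 0, z _, z _, z _, z _, h, z _, by ring⟩
  have mem22 {L} (h : L.IsHomogeneous 1) : X 2 ^ 2 * L ∈ differentialRange Q₀ Q₁ :=
    ⟨0, 0, 0, 0, 0, L, z _, z _, z _, z _, z _, h, by ring⟩
  have memC (t : ℂ) {φ} (h : φ ∈ differentialRange Q₀ Q₁) :
      C t * φ ∈ differentialRange Q₀ Q₁ := by
    simpa only [smul_eq_C_mul] using (differentialRange Q₀ Q₁).smul_mem t h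
  have cancelC {t : ℂ} (ht : t ≠ 0) {φ} (h : C t * φ ∈ differentialRange Q₀ Q₁) :
      φ ∈ differentialRange Q₀ Q₁ := by
    rwa [← smul_eq_C_mul, Submodule.smul_mem_iff _ ht] at h
  obtain ⟨p, q, r, A, B, l, u, v, w, hA, hB, hl, el, eQ⟩ := hQ₀.exists_quadric_expansion
  obtain ⟨p', q', r', A', B', l', u', v', w', hA', hB', hl', el', eQ'⟩ :=
    hQ₁.exists_quadric_expansion
  have noZero (b c : ℂ) (h : p * b ^ 2 + q * (b * c) + r * c ^ 2 = 0)
      (h' : p' * b ^ 2 + q' * (b * c) + r' * c ^ 2 = 0) : b = 0 ∧ c = 0 := by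
    have h0 : eval ![0, 0, 0, b, c] Q₀ = 0 := by rw [eQ]; simpa using h
    have h1 : eval ![0, 0, 0, b, c] Q₁ = 0 := by rw [eQ']; simpa using h'
    have hx := hsm.2 ![0, 0, 0, b, c] fun i => by
      fin_cases i <;> simp [pderiv_X, h0, h1]
    exact ⟨by simpa using congrFun hx 3, by simpa using congrFun hx 4⟩
  have hres : (p * r' - p' * r) ^ 2 - (p * q' - p' * q) * (q * r' - q' * r) ≠ 0 := fun h => by
    obtain ⟨b, c, hbc, h0, h1⟩ := exists_common_zero_of_resultant_eq_zero (sub_eq_zero.1 h)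
    have := noZero b c h0 h1
    tauto
  have hr : r ≠ 0 ∨ r' ≠ 0 := by
    by_contra! h
    exact one_ne_zero (noZero 0 1 (by simp [h.1]) (by simp [h.2])).2
  have mem244 : X 2 * X 4 ^ 2 ∈ differentialRange Q₀ Q₁ := by
    have key : C r * (X 2 * X 4 ^ 2) ∈ differentialRange Q₀ Q₁ := by
      have e : C r * (X 2 * X 4 ^ 2) = X 2 * Q₀ - C p * (X 2 * X 3 * X 3) - C q * (X 2 * X 3 * X 4)
          - X 0 * (X 2 * A) - X 1 * (X 2 * B) - X 2 ^ 2 * l := by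
        rw [eQ]; ring
      rw [e]
      exact sub_mem (sub_mem (sub_mem (sub_mem (sub_mem (memQ0 (x 2)) (memC _ (mem23 (x 3))))
        (memC _ (mem23 (x 4)))) (memX0 ((x 2).mul hA))) (memX1 ((x 2).mul hB))) (mem22 hl)
    have key' : C r' * (X 2 * X 4 ^ 2) ∈ differentialRange Q₀ Q₁ := by
      have e : C r' * (X 2 * X 4 ^ 2) = X 2 * Q₁ - C p' * (X 2 * X 3 * X 3)
          - C q' * (X 2 * X 3 * X 4) - X 0 * (X 2 * A') - X 1 * (X 2 * B') - X 2 ^ 2 * l' := by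
        rw [eQ']; ring
      rw [e]
      exact sub_mem (sub_mem (sub_mem (sub_mem (sub_mem (memQ1 (x 2)) (memC _ (mem23 (x 3))))
        (memC _ (mem23 (x 4)))) (memX0 ((x 2).mul hA'))) (memX1 ((x 2).mul hB'))) (mem22 hl')
    exact hr.elim (cancelC · key) (cancelC · key')
  have memf (i : Fin 5) (hi : i = 3 ∨ i = 4) :
      X i * (C p * X 3 ^ 2 + C q * (X 3 * X 4) + C r * X 4 ^ 2) ∈ differentialRange Q₀ Q₁ := by
    have e : X i * (C p * X 3 ^ 2 + C q * (X 3 * X 4) + C r * X 4 ^ 2) =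
        X i * Q₀ - X 0 * (X i * A) - X 1 * (X i * B) - X i * (X 2 * l) := by rw [eQ]; ring
    rw [e]
    exact sub_mem (sub_mem (sub_mem (memQ0 (x i)) (memX0 ((x i).mul hA))) (memX1 ((x i).mul hB)))
      (el ▸ X_mul_X_two_mul_mem _ mem22 mem23 mem244 i hi u v w)
  have memf' (i : Fin 5) (hi : i = 3 ∨ i = 4) :
      X i * (C p' * X 3 ^ 2 + C q' * (X 3 * X 4) + C r' * X 4 ^ 2) ∈ differentialRange Q₀ Q₁ := by
    have e : X i * (C p' * X 3 ^ 2 + C q' * (X 3 * X 4) + C r' * X 4 ^ 2) =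
        X i * Q₁ - X 0 * (X i * A') - X 1 * (X i * B') - X i * (X 2 * l') := by rw [eQ']; ring
    rw [e]
    exact sub_mem (sub_mem (sub_mem (memQ1 (x i)) (memX0 ((x i).mul hA'))) (memX1 ((x i).mul hB')))
      (el' ▸ X_mul_X_two_mul_mem _ mem22 mem23 mem244 i hi u' v' w')
  obtain ⟨mem333, mem334, mem344, mem444⟩ := binary_cubic_mem_of_resultant_ne_zero _ hres
    (memf 3 (.inl rfl)) (memf 4 (.inr rfl)) (memf' 3 (.inl rfl)) (memf' 4 (.inr rfl))
  exact cubic_mem_of_generators_mem _ memX0 memX1 mem22 mem23 mem244 mem333 mem334 mem344 mem444 hG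
end
end

section
/- Let Q₀, Q₁ ∈ ℂ[z₀,…,z₄] be homogeneous quadrics such that the cubic E₀ = z₀·Q₀ + z₁·Q₁ + z₂²·z₃ is smooth, and set C_i(z₂,z₃,z₄) = Q_i(0,0,z₂,z₃,z₄) for i = 0,1. Then the three quadratic forms C₀, C₁, z₂² on ℂ³ have no common zero other than (0,0,0). -/
open MvPolynomial Module

noncomputable section

/-- If `E₀ = z₀Q₀ + z₁Q₁ + z₂²z₃` is smooth, then the three quadratic forms
`C₀ = Q₀(0,0,z₂,z₃,z₄)`, `C₁ = Q₁(0,0,z₂,z₃,z₄)` and `z₂²` have no common zero on `ℂ³`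
other than the origin. -/
theorem statement16 (Q₀ Q₁ : MvPolynomial (Fin 5) ℂ)
    (hQ₀ : Q₀.IsHomogeneous 2) (hQ₁ : Q₁.IsHomogeneous 2)
    (hsm : IsSmoothCubic (X 0 * Q₀ + X 1 * Q₁ + X 2 ^ 2 * X 3))
    (a b c : ℂ)
    (h₀ : eval ![0, 0, a, b, c] Q₀ = 0)
    (h₁ : eval ![0, 0, a, b, c] Q₁ = 0)
    (h₂ : a ^ 2 = 0) :
    a = 0 ∧ b = 0 ∧ c = 0 := by
  obtain rfl : a = 0 := pow_eq_zero_iff two_ne_zero |>.mp h₂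
  have h := hsm.2 ![0, 0, 0, b, c] fun i => by
    fin_cases i <;> simp [pderiv_X, h₀, h₁]
  exact ⟨rfl, congrFun h 3, congrFun h 4⟩
end
end

section
/- Let Q₀, Q₁ ∈ ℂ[z₀,…,z₄] be homogeneous quadrics such that the cubic E₀ = z₀·Q₀ + z₁·Q₁ + z₂²·z₃ is smooth, and set C_i(z₂,z₃,z₄) = Q_i(0,0,z₂,z₃,z₄) for i = 0,1. Then every homogeneous cubic form in ℂ[z₂,z₃,z₄]₃ can be written as M₀·C₀ + M₁·C₁ + M₃·z₂² + M₄·z₂z₃ for suitable linear forms M₀, M₁, M₃, M₄ ∈ ℂ[z₂,z₃,z₄]₁. -/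
open MvPolynomial Module

noncomputable section

/-- Reduction modulo `z₀, z₁`, sending `z₂, z₃, z₄` to the three variables of
`ℂ[z₂,z₃,z₄]` (realized as `MvPolynomial (Fin 3) ℂ`). -/
def red : MvPolynomial (Fin 5) ℂ →ₐ[ℂ] MvPolynomial (Fin 3) ℂ :=
  aeval ![0, 0, X 0, X 1, X 2]

theorem MvPolynomial.IsHomogeneous.exists_eq_sum_X_mul_s18 {n : ℕ}
    {P : MvPolynomial (Fin 3) ℂ} (hP : P.IsHomogeneous (n + 1)) :
    ∃ L : Fin 3 → MvPolynomial (Fin 3) ℂ, (∀ i, (L i).IsHomogeneous n) ∧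
      P = X 0 * L 0 + X 1 * L 1 + X 2 * L 2 := by
  refine ⟨fun i => C ((n + 1 : ℂ)⁻¹) * pderiv i P, fun i => ?_, ?_⟩
  · exact (hP.pderiv (i := i)).C_mul _
  · have h : ∑ i, X i * pderiv i P = (n + 1) • P := hP.sum_X_mul_pderiv
    rw [Fin.sum_univ_three, nsmul_eq_mul] at h
    have hn : (n + 1 : ℂ) ≠ 0 := by exact_mod_cast n.succ_ne_zero
    have hc : C ((n + 1 : ℂ)⁻¹) * ((n + 1 : ℕ) : MvPolynomial (Fin 3) ℂ) = 1 := by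
      rw [← map_natCast (C : ℂ →+* MvPolynomial (Fin 3) ℂ), ← MvPolynomial.C_mul]
      push_cast
      rw [inv_mul_cancel₀ hn, C_1]
    linear_combination (-C ((n + 1 : ℂ)⁻¹)) * h - P * hc

theorem MvPolynomial.IsHomogeneous.exists_eq_linear_form
    {P : MvPolynomial (Fin 3) ℂ} (hP : P.IsHomogeneous 1) :
    ∃ a b c : ℂ, P = C a * X 0 + C b * X 1 + C c * X 2 := by
  obtain ⟨L, hL, rfl⟩ := hP.exists_eq_sum_X_mul_s18 (n := 0)
  choose c hc using fun i => (⟨_, totalDegree_eq_zero_iff_eq_C.1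
    (Nat.le_zero.1 (hL i).totalDegree_le)⟩ : ∃ c, L i = C c)
  exact ⟨c 0, c 1, c 2, by simp only [hc]; ring⟩

/-- A ternary quadratic form is a multiple of the first variable plus a binary form. -/
theorem MvPolynomial.IsHomogeneous.exists_eq_quadratic_form
    {P : MvPolynomial (Fin 3) ℂ} (hP : P.IsHomogeneous 2) :
    ∃ (L : MvPolynomial (Fin 3) ℂ) (a b c : ℂ), L.IsHomogeneous 1 ∧
      P = X 0 * L + (C a * X 1 ^ 2 + C b * (X 1 * X 2) + C c * X 2 ^ 2) := by
  obtain ⟨L, hL, rfl⟩ := hP.exists_eq_sum_X_mul_s18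
  obtain ⟨p, q, r, h₁⟩ := (hL 1).exists_eq_linear_form
  obtain ⟨s, t, u, h₂⟩ := (hL 2).exists_eq_linear_form
  refine ⟨L 0 + C p * X 1 + C s * X 2, q, r + t, u,
    ((hL 0).add (isHomogeneous_C_mul_X p 1)).add (isHomogeneous_C_mul_X s 2), ?_⟩
  rw [h₁, h₂, C_add]
  ring

/-- Two binary quadratic forms with vanishing resultant have a common nontrivial zero. -/
theorem exists_common_zero_of_resultant_eq_zero_s18 (a₀ b₀ c₀ a₁ b₁ c₁ : ℂ)
    (hR : (a₀ * c₁ - a₁ * c₀) ^ 2 - (a₀ * b₁ - a₁ * b₀) * (b₀ * c₁ - b₁ * c₀) = 0) :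
    ∃ u v : ℂ, (u ≠ 0 ∨ v ≠ 0) ∧ a₀ * u ^ 2 + b₀ * (u * v) + c₀ * v ^ 2 = 0 ∧
      a₁ * u ^ 2 + b₁ * (u * v) + c₁ * v ^ 2 = 0 := by
  have root (a b c : ℂ) (ha : a ≠ 0) :
      ∃ u v : ℂ, (u ≠ 0 ∨ v ≠ 0) ∧ a * u ^ 2 + b * (u * v) + c * v ^ 2 = 0 := by
    obtain ⟨s, hs⟩ := IsAlgClosed.exists_pow_nat_eq (b ^ 2 - 4 * a * c) two_pos
    exact ⟨-b + s, 2 * a, .inr (by simpa using ha), by linear_combination a * hs⟩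
  by_cases hB : a₀ * c₁ - a₁ * c₀ = 0
  · by_cases hA : a₀ * b₁ - a₁ * b₀ = 0
    · by_cases h₀ : a₀ = 0
      · by_cases h₁ : a₁ = 0
        · exact ⟨1, 0, by simp, by simp [h₀], by simp [h₁]⟩
        · obtain ⟨u, v, huv, h⟩ := root a₁ b₁ c₁ h₁
          refine ⟨u, v, huv, mul_left_cancel₀ h₁ ?_, h⟩
          linear_combination a₀ * h - (u * v) * hA - v ^ 2 * hB
      · obtain ⟨u, v, huv, h⟩ := root a₀ b₀ c₀ h₀
        refine ⟨u, v, huv, h, mul_left_cancel₀ h₀ ?_⟩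
        linear_combination a₁ * h + (u * v) * hA + v ^ 2 * hB
    · have hD : b₀ * c₁ - b₁ * c₀ = 0 := by
        refine mul_left_cancel₀ hA ?_
        linear_combination (a₀ * c₁ - a₁ * c₀) * hB - hR
      have h₀ : c₀ = 0 := by
        refine mul_left_cancel₀ hA ?_
        linear_combination b₀ * hB - a₀ * hD
      have h₁ : c₁ = 0 := by
        refine mul_left_cancel₀ hA ?_
        linear_combination b₁ * hB - a₁ * hD
      exact ⟨0, 1, by simp, by simp [h₀], by simp [h₁]⟩
  · refine ⟨a₀ * c₁ - a₁ * c₀, -(a₀ * b₁ - a₁ * b₀), .inl hB,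
      mul_left_cancel₀ hB ?_, mul_left_cancel₀ hB ?_⟩
    · linear_combination (a₀ * (a₀ * c₁ - a₁ * c₀)) * hR
    · linear_combination (a₁ * (a₀ * c₁ - a₁ * c₀)) * hR

/-- If the binary parts of two ternary quadratic forms `P₀, P₁` have nonzero resultant, then
every space containing the linear multiples of `P₀`, `P₁`, `X₀²` and `X₀X₁` contains
all cubic forms. -/
theorem cubic_mem_of_resultant_ne_zero {P₀ P₁ L₀ L₁ G : MvPolynomial (Fin 3) ℂ}
    {a₀ b₀ c₀ a₁ b₁ c₁ : ℂ} (hL₀ : L₀.IsHomogeneous 1) (hL₁ : L₁.IsHomogeneous 1)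
    (hP₀ : P₀ = X 0 * L₀ + (C a₀ * X 1 ^ 2 + C b₀ * (X 1 * X 2) + C c₀ * X 2 ^ 2))
    (hP₁ : P₁ = X 0 * L₁ + (C a₁ * X 1 ^ 2 + C b₁ * (X 1 * X 2) + C c₁ * X 2 ^ 2))
    (hR : (a₀ * c₁ - a₁ * c₀) ^ 2 - (a₀ * b₁ - a₁ * b₀) * (b₀ * c₁ - b₁ * c₀) ≠ 0)
    (W : Submodule ℂ (MvPolynomial (Fin 3) ℂ))
    (hW₀ : ∀ L : MvPolynomial (Fin 3) ℂ, L.IsHomogeneous 1 → L * P₀ ∈ W)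
    (hW₁ : ∀ L : MvPolynomial (Fin 3) ℂ, L.IsHomogeneous 1 → L * P₁ ∈ W)
    (hW₃ : ∀ L : MvPolynomial (Fin 3) ℂ, L.IsHomogeneous 1 → L * X 0 ^ 2 ∈ W)
    (hW₄ : ∀ L : MvPolynomial (Fin 3) ℂ, L.IsHomogeneous 1 → L * (X 0 * X 1) ∈ W)
    (hG : G.IsHomogeneous 3) : G ∈ W := by
  have hX (i : Fin 3) : (X i : MvPolynomial (Fin 3) ℂ).IsHomogeneous 1 := isHomogeneous_X ℂ i
  have smul_mem {F : MvPolynomial (Fin 3) ℂ} (c : ℂ) (hF : F ∈ W) : C c * F ∈ W := by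
    rw [C_mul']; exact W.smul_mem c hF
  have of_smul {F : MvPolynomial (Fin 3) ℂ} {c : ℂ} (hc : c ≠ 0) (h : C c * F ∈ W) : F ∈ W := by
    rw [C_mul'] at h; exact (W.smul_mem_iff hc).1 h
  have ha : a₀ ≠ 0 ∨ a₁ ≠ 0 := by
    by_contra! h
    exact hR (by rw [h.1, h.2]; ring)
  have hc : c₀ ≠ 0 ∨ c₁ ≠ 0 := by
    by_contra! h
    exact hR (by rw [h.1, h.2]; ring)
  have X0_lin_mem {P L : MvPolynomial (Fin 3) ℂ} {a b c : ℂ} (hL : L.IsHomogeneous 1)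
      (hP : P = X 0 * L + (C a * X 1 ^ 2 + C b * (X 1 * X 2) + C c * X 2 ^ 2))
      (hPW : X 0 * P ∈ W) : C c * (X 0 * X 2 ^ 2) ∈ W := by
    have h := sub_mem (sub_mem (sub_mem hPW (hW₃ L hL)) (smul_mem a (hW₄ _ (hX 1))))
      (smul_mem b (hW₄ _ (hX 2)))
    convert h using 1
    rw [hP]; ring
  have h022 : X 0 * X 2 ^ 2 ∈ W := hc.elim
    (fun h => of_smul h (X0_lin_mem hL₀ hP₀ (hW₀ _ (hX 0))))
    (fun h => of_smul h (X0_lin_mem hL₁ hP₁ (hW₁ _ (hX 0))))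
  have X0_mul_mem {H : MvPolynomial (Fin 3) ℂ} (hH : H.IsHomogeneous 2) : X 0 * H ∈ W := by
    obtain ⟨L, a, b, c, hL, rfl⟩ := hH.exists_eq_quadratic_form
    have h := add_mem (add_mem (add_mem (hW₃ L hL) (smul_mem a (hW₄ _ (hX 1))))
      (smul_mem b (hW₄ _ (hX 2)))) (smul_mem c h022)
    convert h using 1
    ring
  have binary_mem {P L M : MvPolynomial (Fin 3) ℂ} {a b c : ℂ} (hL : L.IsHomogeneous 1)
      (hP : P = X 0 * L + (C a * X 1 ^ 2 + C b * (X 1 * X 2) + C c * X 2 ^ 2))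
      (hM : M.IsHomogeneous 1) (hPW : M * P ∈ W) :
      M * (C a * X 1 ^ 2 + C b * (X 1 * X 2) + C c * X 2 ^ 2) ∈ W := by
    have h := sub_mem hPW (X0_mul_mem (hL.mul hM))
    convert h using 1
    rw [hP]; ring
  have hq₀ (i : Fin 3) := binary_mem hL₀ hP₀ (hX i) (hW₀ _ (hX i))
  have hq₁ (i : Fin 3) := binary_mem hL₁ hP₁ (hX i) (hW₁ _ (hX i))
  have hA : X 1 * (X 2 * (C (a₀ * b₁ - a₁ * b₀) * X 1 + C (a₀ * c₁ - a₁ * c₀) * X 2)) ∈ W := by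
    have h := sub_mem (smul_mem a₀ (hq₁ 1)) (smul_mem a₁ (hq₀ 1))
    convert h using 1
    simp only [C_sub, C_mul]; ring
  have hD : X 2 * (X 1 * (C (a₀ * c₁ - a₁ * c₀) * X 1 + C (b₀ * c₁ - b₁ * c₀) * X 2)) ∈ W := by
    have h := sub_mem (smul_mem c₁ (hq₀ 2)) (smul_mem c₀ (hq₁ 2))
    convert h using 1
    simp only [C_sub, C_mul]; ring
  have h112 : X 1 ^ 2 * X 2 ∈ W := by
    refine of_smul hR ?_
    have h := sub_mem (smul_mem (a₀ * c₁ - a₁ * c₀) hD) (smul_mem (b₀ * c₁ - b₁ * c₀) hA)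
    convert h using 1
    simp only [C_sub, C_mul, C_pow]; ring
  have h122 : X 1 * X 2 ^ 2 ∈ W := by
    refine of_smul hR ?_
    have h := sub_mem (smul_mem (a₀ * c₁ - a₁ * c₀) hA) (smul_mem (a₀ * b₁ - a₁ * b₀) hD)
    convert h using 1
    simp only [C_sub, C_mul, C_pow]; ring
  have X1_cube {a b c : ℂ}
      (h : X 1 * (C a * X 1 ^ 2 + C b * (X 1 * X 2) + C c * X 2 ^ 2) ∈ W) :
      C a * X 1 ^ 3 ∈ W := by
    have h := sub_mem (sub_mem h (smul_mem b h112)) (smul_mem c h122)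
    convert h using 1
    ring
  have X2_cube {a b c : ℂ}
      (h : X 2 * (C a * X 1 ^ 2 + C b * (X 1 * X 2) + C c * X 2 ^ 2) ∈ W) :
      C c * X 2 ^ 3 ∈ W := by
    have h := sub_mem (sub_mem h (smul_mem a h112)) (smul_mem b h122)
    convert h using 1
    ring
  have h111 : X 1 ^ 3 ∈ W :=
    ha.elim (fun h => of_smul h (X1_cube (hq₀ 1))) (fun h => of_smul h (X1_cube (hq₁ 1)))
  have h222 : X 2 ^ 3 ∈ W :=
    hc.elim (fun h => of_smul h (X2_cube (hq₀ 2))) (fun h => of_smul h (X2_cube (hq₁ 2)))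
  obtain ⟨H, hH, rfl⟩ := hG.exists_eq_sum_X_mul_s18
  obtain ⟨K₁, p₁, q₁, r₁, hK₁, h₁⟩ := (hH 1).exists_eq_quadratic_form
  obtain ⟨K₂, p₂, q₂, r₂, hK₂, h₂⟩ := (hH 2).exists_eq_quadratic_form
  have hx₀ := add_mem (add_mem (X0_mul_mem (hH 0)) (X0_mul_mem ((hX 1).mul hK₁)))
    (X0_mul_mem ((hX 2).mul hK₂))
  have hx₁ := add_mem (add_mem (smul_mem p₁ h111) (smul_mem (q₁ + p₂) h112))
    (add_mem (smul_mem (r₁ + q₂) h122) (smul_mem r₂ h222))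
  convert add_mem hx₀ hx₁ using 1
  rw [h₁, h₂, C_add, C_add]
  ring

theorem red_isHomogeneous {Q : MvPolynomial (Fin 5) ℂ} {n : ℕ} (hQ : Q.IsHomogeneous n) :
    (red Q).IsHomogeneous n := by
  have h : (red Q).IsHomogeneous (1 * n) := by
    refine hQ.aeval _ fun i => ?_
    fin_cases i
    · exact isHomogeneous_zero ..
    · exact isHomogeneous_zero ..
    all_goals exact isHomogeneous_X ..
  rwa [one_mul] at h

theorem eval_red (Q : MvPolynomial (Fin 5) ℂ) (x : Fin 3 → ℂ) :
    eval x (red Q) = eval ![0, 0, x 0, x 1, x 2] Q := by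
  have h : (aeval x : MvPolynomial (Fin 3) ℂ →ₐ[ℂ] ℂ).comp red =
      aeval ![0, 0, x 0, x 1, x 2] := by
    ext i
    fin_cases i <;> simp [red]
  simpa [coe_aeval_eq_eval] using DFunLike.congr_fun h Q

theorem eq_zero_of_isSmoothCubic {Q₀ Q₁ : MvPolynomial (Fin 5) ℂ}
    (hsm : IsSmoothCubic (X 0 * Q₀ + X 1 * Q₁ + X 2 ^ 2 * X 3)) {u v : ℂ}
    (h₀ : eval ![0, u, v] (red Q₀) = 0) (h₁ : eval ![0, u, v] (red Q₁) = 0) :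
    u = 0 ∧ v = 0 := by
  rw [eval_red] at h₀ h₁
  have h := hsm.2 ![0, 0, 0, u, v] fun i => by
    fin_cases i <;> simp_all [pderiv_X]
  exact ⟨congrFun h 3, congrFun h 4⟩

/-- If `E₀ = z₀Q₀ + z₁Q₁ + z₂²z₃` is smooth, then every cubic form in `ℂ[z₂,z₃,z₄]` can be
written as `M₀C₀ + M₁C₁ + M₃z₂² + M₄z₂z₃` with linear forms `M₀, M₁, M₃, M₄`, where
`Cᵢ = Qᵢ(0,0,z₂,z₃,z₄)`. -/
theorem statement18 (Q₀ Q₁ : MvPolynomial (Fin 5) ℂ)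
    (hQ₀ : Q₀.IsHomogeneous 2) (hQ₁ : Q₁.IsHomogeneous 2)
    (hsm : IsSmoothCubic (X 0 * Q₀ + X 1 * Q₁ + X 2 ^ 2 * X 3))
    (G : MvPolynomial (Fin 3) ℂ) (hG : G.IsHomogeneous 3) :
    ∃ M₀ M₁ M₃ M₄ : MvPolynomial (Fin 3) ℂ,
      M₀.IsHomogeneous 1 ∧ M₁.IsHomogeneous 1 ∧ M₃.IsHomogeneous 1 ∧ M₄.IsHomogeneous 1 ∧
      G = M₀ * red Q₀ + M₁ * red Q₁ + M₃ * X 0 ^ 2 + M₄ * (X 0 * X 1) := by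
  obtain ⟨L₀, a₀, b₀, c₀, hL₀, hP₀⟩ := (red_isHomogeneous hQ₀).exists_eq_quadratic_form
  obtain ⟨L₁, a₁, b₁, c₁, hL₁, hP₁⟩ := (red_isHomogeneous hQ₁).exists_eq_quadratic_form
  have hR : (a₀ * c₁ - a₁ * c₀) ^ 2 - (a₀ * b₁ - a₁ * b₀) * (b₀ * c₁ - b₁ * c₀) ≠ 0 := by
    intro hR
    obtain ⟨u, v, huv, h₀, h₁⟩ := exists_common_zero_of_resultant_eq_zero_s18 _ _ _ _ _ _ hR
    have h := eq_zero_of_isSmoothCubic hsm (u := u) (v := v)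
      (by rw [hP₀]; simpa using h₀) (by rw [hP₁]; simpa using h₁)
    exact huv.elim (· h.1) (· h.2)
  let W : Submodule ℂ (MvPolynomial (Fin 3) ℂ) :=
    { carrier := {F | ∃ M₀ M₁ M₃ M₄ : MvPolynomial (Fin 3) ℂ,
        M₀.IsHomogeneous 1 ∧ M₁.IsHomogeneous 1 ∧ M₃.IsHomogeneous 1 ∧ M₄.IsHomogeneous 1 ∧
        F = M₀ * red Q₀ + M₁ * red Q₁ + M₃ * X 0 ^ 2 + M₄ * (X 0 * X 1)}
      zero_mem' := ⟨0, 0, 0, 0, isHomogeneous_zero .., isHomogeneous_zero ..,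
        isHomogeneous_zero .., isHomogeneous_zero .., by ring⟩
      add_mem' := by
        rintro _ _ ⟨M₀, M₁, M₃, M₄, h₀, h₁, h₃, h₄, rfl⟩ ⟨N₀, N₁, N₃, N₄, k₀, k₁, k₃, k₄, rfl⟩
        exact ⟨M₀ + N₀, M₁ + N₁, M₃ + N₃, M₄ + N₄, h₀.add k₀, h₁.add k₁, h₃.add k₃, h₄.add k₄,
          by ring⟩
      smul_mem' := by
        rintro c _ ⟨M₀, M₁, M₃, M₄, h₀, h₁, h₃, h₄, rfl⟩
        exact ⟨C c * M₀, C c * M₁, C c * M₃, C c * M₄, h₀.C_mul c, h₁.C_mul c, h₃.C_mul c,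
          h₄.C_mul c, by rw [← C_mul']; ring⟩ }
  have z : (0 : MvPolynomial (Fin 3) ℂ).IsHomogeneous 1 := isHomogeneous_zero ..
  exact cubic_mem_of_resultant_ne_zero hL₀ hL₁ hP₀ hP₁ hR W
    (fun L hL => ⟨L, 0, 0, 0, hL, z, z, z, by ring⟩)
    (fun L hL => ⟨0, L, 0, 0, z, hL, z, z, by ring⟩)
    (fun L hL => ⟨0, 0, L, 0, z, z, hL, z, by ring⟩)
    (fun L hL => ⟨0, 0, 0, L, z, z, z, hL, by ring⟩) hG
end
end

section
/- Let q₀, q₁, q₂ be quadratic forms in ℂ[x,y,z] whose only common zero in ℂ³ is the origin, let I = (q₀, q₁, q₂) be the ideal they generate, and R_I = ℂ[x,y,z]/I. Then the degree-3 graded piece R_I³ of R_I is 1-dimensional, and the multiplication pairings R_I^i ⊗ R_I^{3−i} → R_I³ are perfect for 0 ≤ i ≤ 3: for every nonzero class a ∈ R_I^i there is b ∈ R_I^{3−i} with a·b ≠ 0 in R_I³. -/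
open MvPolynomial Module

noncomputable section

/-- The degree-`d` graded piece of `ℂ[x,y,z]/I`, realized as the image of the homogeneous
polynomials of degree `d` in the quotient. -/
def gradedPiece (I : Ideal (MvPolynomial (Fin 3) ℂ)) (d : ℕ) :
    Submodule ℂ (MvPolynomial (Fin 3) ℂ ⧸ I.restrictScalars ℂ) :=
  Submodule.map (Submodule.mkQ (I.restrictScalars ℂ)) (homogeneousSubmodule (Fin 3) ℂ d)

variable {K : Type*} [Field K]

theorem mem_span_X_zero_one_of_X_two_mul_mem {e : MvPolynomial (Fin 3) K}
    (h : X 2 * e ∈ Ideal.span ({X 0, X 1} : Set (MvPolynomial (Fin 3) K))) :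
    e ∈ Ideal.span ({X 0, X 1} : Set (MvPolynomial (Fin 3) K)) := by
  rw [← Set.image_pair, mem_ideal_span_X_image] at h ⊢
  intro m hm
  obtain ⟨i, hi, hne⟩ := h (Finsupp.single 2 1 + m) (by
    rw [MvPolynomial.mem_support_iff, coeff_X_mul]; exact MvPolynomial.mem_support_iff.mp hm)
  refine ⟨i, hi, ?_⟩
  rcases hi with rfl | rfl <;> simpa using hne

theorem exists_eq_mul_of_X_mul_eq_X_mul {i j : Fin 3} (hij : i ≠ j)
    {f g : MvPolynomial (Fin 3) K} (h : X j * f = X i * g) : ∃ c, f = X i * c := by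
  have hd : (X i : MvPolynomial (Fin 3) K) ∣ X j * f := ⟨g, h⟩
  rcases (X_prime (i := i)).dvd_or_dvd hd with h' | ⟨c, hc⟩
  · exact absurd (X_dvd_X.mp h') hij
  · exact ⟨c, hc⟩

/-- The syzygies of two relatively prime elements are the multiples of the obvious one. -/
theorem IsRelPrime.exists_of_mul_add_mul_eq_zero {R : Type*} [CommRing R] [IsDomain R]
    [DecompositionMonoid R] {p q a b : R} (hpq : IsRelPrime p q) (hq : q ≠ 0)
    (h : a * p + b * q = 0) : ∃ e, a = e * q ∧ b = -(e * p) := by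
  obtain ⟨e, he⟩ : q ∣ a := hpq.symm.dvd_of_dvd_mul_right ⟨-b, by linear_combination h⟩
  refine ⟨e, by rw [he, mul_comm], mul_right_cancel₀ hq ?_⟩
  subst he
  linear_combination h

/-- The ideal generated by two relatively prime polynomials in three variables has no socle. -/
theorem mem_span_pair_of_X_mul_mem {p q f : MvPolynomial (Fin 3) K} (hpq : IsRelPrime p q)
    (hq : q ≠ 0) (h : ∀ i, X i * f ∈ Ideal.span {p, q}) : f ∈ Ideal.span {p, q} := by
  simp only [Ideal.mem_span_pair] at h
  choose a b hab using h
  have syz (i j : Fin 3) : ∃ e, X j * a i - X i * a j = e * q ∧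
      X j * b i - X i * b j = -(e * p) :=
    hpq.exists_of_mul_add_mul_eq_zero hq (by linear_combination X j * hab i - X i * hab j)
  obtain ⟨e, ha, hb⟩ := syz 0 1
  obtain ⟨e', ha', -⟩ := syz 1 2
  obtain ⟨e'', ha'', -⟩ := syz 2 0
  have hsum : X 2 * e + X 0 * e' + X 1 * e'' = 0 := by
    apply mul_right_cancel₀ hq
    linear_combination -(X 2 * ha + X 0 * ha' + X 1 * ha'')
  obtain ⟨u, v, huv⟩ := Ideal.mem_span_pair.mp <| mem_span_X_zero_one_of_X_two_mul_mem <|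
    Ideal.mem_span_pair.mpr ⟨-e', -e'', show _ = X 2 * e by linear_combination -hsum⟩
  obtain ⟨α, hα⟩ := exists_eq_mul_of_X_mul_eq_X_mul (i := 0) (j := 1) (by decide)
    (show X 1 * (a 0 - v * q) = X 0 * (a 1 + u * q) by
      linear_combination ha - q * huv)
  obtain ⟨β, hβ⟩ := exists_eq_mul_of_X_mul_eq_X_mul (i := 0) (j := 1) (by decide)
    (show X 1 * (b 0 + v * p) = X 0 * (b 1 - u * p) by
      linear_combination hb + p * huv)
  refine Ideal.mem_span_pair.mpr ⟨α, β, mul_left_cancel₀ (X_ne_zero (0 : Fin 3)) ?_⟩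
  linear_combination hab 0 - p * hα - q * hβ

theorem mem_span_pair_of_mul_mem {p q r f : MvPolynomial (Fin 3) K} (hpq : IsRelPrime p q)
    (hq : q ≠ 0) (hX : ∀ i, X i ∈ (Ideal.span {p, q, r}).radical)
    (h : r * f ∈ Ideal.span {p, q}) : f ∈ Ideal.span {p, q} := by
  by_contra hf
  obtain ⟨P, hP, hle⟩ := exists_le_isAssociatedPrime_of_isNoetherianRing (MvPolynomial (Fin 3) K)
    (Ideal.Quotient.mk (Ideal.span {p, q}) f) (by rwa [Ne, Ideal.Quotient.eq_zero_iff_mem])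
  have mem_colon (s g : MvPolynomial (Fin 3) K) :
      s ∈ (⊥ : Submodule (MvPolynomial (Fin 3) K) (MvPolynomial (Fin 3) K ⧸ Ideal.span {p, q})).colon
        {Ideal.Quotient.mk (Ideal.span {p, q}) g} ↔ s * g ∈ Ideal.span {p, q} := by
    rw [Submodule.mem_colon_singleton, Submodule.mem_bot, ← Ideal.Quotient.eq_zero_iff_mem, map_mul]
    rfl
  obtain ⟨hprime, x, hx⟩ := isAssociatedPrime_iff.mp hP
  obtain ⟨g, rfl⟩ := Ideal.Quotient.mk_surjective x
  have hIP : Ideal.span {p, q, r} ≤ P := by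
    rw [Ideal.span_le]
    rintro s (rfl | rfl | rfl)
    · exact hle ((mem_colon _ _).mpr (Ideal.mul_mem_right _ _ (Ideal.subset_span (by simp))))
    · exact hle ((mem_colon _ _).mpr (Ideal.mul_mem_right _ _ (Ideal.subset_span (by simp))))
    · exact hle ((mem_colon _ _).mpr h)
  have hg : g ∈ Ideal.span {p, q} := mem_span_pair_of_X_mul_mem hpq hq fun i =>
    (mem_colon _ _).mp (hx ▸ hprime.radical_le_iff.mpr hIP (hX i))
  apply hprime.ne_top
  rw [Ideal.eq_top_iff_one, hx, mem_colon, one_mul]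
  exact hg

/-- An ideal of a polynomial ring in three variables whose radical contains all variables and
which is generated by two elements is the unit ideal. -/
theorem span_pair_eq_top_of_X_mem_radical {p q : MvPolynomial (Fin 3) K}
    (hX : ∀ i, X i ∈ (Ideal.span {p, q}).radical) : Ideal.span {p, q} = ⊤ := by
  have hpq : IsRelPrime p q := by
    intro h hp hq
    have hle : Ideal.span {p, q} ≤ Ideal.span {h} := by
      rw [Ideal.span_le]
      rintro s (rfl | rfl) <;> exact Ideal.mem_span_singleton.mpr ‹_›
    have hdvd (i : Fin 3) : ∃ n, h ∣ X i ^ n := by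
      obtain ⟨n, hn⟩ := hX i
      exact ⟨n, Ideal.mem_span_singleton.mp (hle hn)⟩
    obtain ⟨m, hm⟩ := hdvd 0
    obtain ⟨n, hn⟩ := hdvd 1
    have hrel : IsRelPrime (X 0 ^ m : MvPolynomial (Fin 3) K) (X 1 ^ n) := by
      refine IsRelPrime.pow ((X_prime.irreducible.isRelPrime_iff_not_dvd).mpr fun hd => ?_)
      exact absurd (X_dvd_X.mp hd) (by decide)
    exact hrel hm hn
  rcases eq_or_ne q 0 with rfl | hq
  · exact Ideal.eq_top_of_isUnit_mem _ (Ideal.subset_span (by simp))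
      (isRelPrime_zero_right.mp hpq)
  · rw [Ideal.eq_top_iff_one]
    refine mem_span_pair_of_mul_mem (r := 0) hpq hq (fun i => ?_) (by simp)
    exact Ideal.radical_mono (Ideal.span_mono (by grind)) (hX i)

theorem two_le_totalDegree_of_mem {q r h : MvPolynomial (Fin 3) K} (hq : q.IsHomogeneous 2)
    (hr : r.IsHomogeneous 2) (hh : h ∈ Ideal.span {q, r}) (h0 : h ≠ 0) : 2 ≤ h.totalDegree := by
  have key : ∀ {s : MvPolynomial (Fin 3) K}, s.IsHomogeneous 2 → s ∈ idealOfVars (Fin 3) K ^ 2 := by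
    intro s hs
    rw [mem_pow_idealOfVars_iff']
    exact fun x hx => hs.coeff_eq_zero hx.ne
  have hle : Ideal.span {q, r} ≤ idealOfVars (Fin 3) K ^ 2 := by
    rw [Ideal.span_le]
    rintro s (rfl | rfl)
    exacts [key hq, key hr]
  obtain ⟨x, hx⟩ := ne_zero_iff.mp h0
  have hx' := MvPolynomial.mem_support_iff.mpr hx
  exact ((mem_pow_idealOfVars_iff _ _).mp (hle hh) x hx').trans
    (by simpa [Finsupp.degree_eq_sum, Finsupp.sum_fintype] using le_totalDegree hx')

theorem ne_zero_of_X_mem_radical {p q r : MvPolynomial (Fin 3) K} (hq : q.IsHomogeneous 2)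
    (hr : r.IsHomogeneous 2) (hX : ∀ i, X i ∈ (Ideal.span {p, q, r}).radical) : p ≠ 0 := by
  rintro rfl
  have h1 : (1 : MvPolynomial (Fin 3) K) ∈ Ideal.span {q, r} := by
    rw [← Ideal.eq_top_iff_one]
    refine span_pair_eq_top_of_X_mem_radical ?_
    simpa only [Ideal.span_insert_zero] using hX
  simpa using two_le_totalDegree_of_mem hq hr h1 one_ne_zero

theorem isRelPrime_of_X_mem_radical {p q r : MvPolynomial (Fin 3) K} (hp : p.IsHomogeneous 2)
    (hq : q.IsHomogeneous 2) (hr : r.IsHomogeneous 2)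
    (hX : ∀ i, X i ∈ (Ideal.span {p, q, r}).radical) : IsRelPrime p q := by
  rintro g ⟨h, rfl⟩ ⟨k, rfl⟩
  have h0 := ne_zero_of_X_mem_radical hq hr hX
  have hle : Ideal.span {g * h, g * k, r} ≤ Ideal.span {g, r} := by
    rw [Ideal.span_le]
    rintro s (rfl | rfl | rfl)
    · exact Ideal.mul_mem_right _ _ (Ideal.subset_span (by simp))
    · exact Ideal.mul_mem_right _ _ (Ideal.subset_span (by simp))
    · exact Ideal.subset_span (by simp)
  have htop := span_pair_eq_top_of_X_mem_radical fun i => Ideal.radical_mono hle (hX i)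
  obtain ⟨u, v, huv⟩ := Ideal.mem_span_pair.mp ((Ideal.eq_top_iff_one _).mp htop)
  have hmem : h ∈ Ideal.span {g * h, r} :=
    Ideal.mem_span_pair.mpr ⟨u, v * h, by linear_combination h * huv⟩
  have h2 := two_le_totalDegree_of_mem hp hr hmem (right_ne_zero_of_mul h0)
  have hdeg := totalDegree_mul_of_isDomain (left_ne_zero_of_mul h0) (right_ne_zero_of_mul h0)
  rw [hp.totalDegree h0] at hdeg
  obtain ⟨c, rfl⟩ : ∃ c, g = C c := ⟨_, totalDegree_eq_zero_iff_eq_C.mp (by lia)⟩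
  refine (isUnit_iff_ne_zero.mpr ?_).map C
  rintro rfl
  simp at h0

theorem homogeneousComponent_add_mul {σ R : Type*} [CommRing R] {q : MvPolynomial σ R} {m : ℕ}
    (hq : q.IsHomogeneous m) (n : ℕ) (a : MvPolynomial σ R) :
    homogeneousComponent (n + m) (a * q) = homogeneousComponent n a * q := by
  let _ := gradedAlgebra (σ := σ) (R := R)
  have h := DirectSum.coe_decompose_mul_of_right_mem_of_le (homogeneousSubmodule σ R) (a := a)
    (b := q) (i := m) (n := n + m) hq (Nat.le_add_left _ _)
  rw [Nat.add_sub_cancel] at h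
  rw [← decomposition.decompose'_apply, ← decomposition.decompose'_apply]
  exact h

/-- A homogeneous element of an ideal generated by three forms of the same degree is a
combination of the generators with homogeneous coefficients. -/
theorem exists_isHomogeneous_of_mem_span_triple {σ R : Type*} [CommRing R]
    {p q r f : MvPolynomial σ R} {m n : ℕ} (hp : p.IsHomogeneous m) (hq : q.IsHomogeneous m)
    (hr : r.IsHomogeneous m) (hf : f.IsHomogeneous (n + m)) (h : f ∈ Ideal.span {p, q, r}) :
    ∃ a b c : MvPolynomial σ R, a.IsHomogeneous n ∧ b.IsHomogeneous n ∧ c.IsHomogeneous n ∧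
      a * p + b * q + c * r = f := by
  obtain ⟨a, b, c, habc⟩ := Submodule.mem_span_triple.mp h
  refine ⟨homogeneousComponent n a, homogeneousComponent n b, homogeneousComponent n c,
    homogeneousComponent_isHomogeneous _ _, homogeneousComponent_isHomogeneous _ _,
    homogeneousComponent_isHomogeneous _ _, ?_⟩
  rw [← homogeneousComponent_add_mul hp, ← homogeneousComponent_add_mul hq,
    ← homogeneousComponent_add_mul hr, ← map_add, ← map_add]
  simp only [smul_eq_mul] at habc
  rw [habc, homogeneousComponent_eq_self hf]

theorem exists_C_of_isHomogeneous_zero {σ R : Type*} [CommRing R] {f : MvPolynomial σ R}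
    (hf : f.IsHomogeneous 0) : ∃ c, f = C c :=
  ⟨_, totalDegree_eq_zero_iff_eq_C.mp (Nat.le_zero.mp hf.totalDegree_le)⟩

theorem exists_C_of_mem_span_pair {σ R : Type*} [CommRing R]
    {p q f : MvPolynomial σ R} {m : ℕ} (hp : p.IsHomogeneous m) (hq : q.IsHomogeneous m)
    (hf : f.IsHomogeneous m) (h : f ∈ Ideal.span {p, q}) :
    ∃ a b : R, C a * p + C b * q = f := by
  obtain ⟨a, b, c, ha, hb, -, habc⟩ := exists_isHomogeneous_of_mem_span_triple (n := 0) hp hq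
    (isHomogeneous_zero _ _ _) (by simpa using hf)
    (Ideal.span_mono (by grind) h : f ∈ Ideal.span {p, q, 0})
  obtain ⟨a, rfl⟩ := exists_C_of_isHomogeneous_zero ha
  obtain ⟨b, rfl⟩ := exists_C_of_isHomogeneous_zero hb
  exact ⟨a, b, by simpa using habc⟩

theorem eq_zero_of_mem_span_pair {f q r : MvPolynomial (Fin 3) K} (hf : f.IsHomogeneous 1)
    (hq : q.IsHomogeneous 2) (hr : r.IsHomogeneous 2) (h : f ∈ Ideal.span {q, r}) : f = 0 := by
  by_contra h0
  have := two_le_totalDegree_of_mem hq hr h h0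
  rw [hf.totalDegree h0] at this
  omega

theorem finrank_homogeneousSubmodule (n : ℕ) :
    finrank K (homogeneousSubmodule (Fin 3) K n) = (n + 2).choose 2 := by
  rw [homogeneousSubmodule_eq_finsupp_supported]
  have hset : {d : Fin 3 →₀ ℕ | d.degree = n} =
      ((Finset.univ : Finset (Fin 3)).finsuppAntidiag n : Set (Fin 3 →₀ ℕ)) := by
    ext d
    simp [Finsupp.degree_eq_sum]
  rw [hset, (AddMonoidAlgebra.supportedEquivFinsupp _).finrank_eq, finrank_finsupp_self]
  simp only [Finset.coe_sort_coe, Fintype.card_coe, Finset.card_finsuppAntidiag_nat_eq_choose,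
    Finset.card_univ, Fintype.card_fin]
  rw [show 3 + n - 1 = n + 2 by omega, Nat.choose_symm_add]

/-- Three quadratic forms in three variables with no common zero outside the origin, the latter
being phrased as the irrelevant ideal lying in the radical of the ideal they generate. -/
structure IsQuadricCompleteIntersection (p q r : MvPolynomial (Fin 3) K) : Prop where
  left : p.IsHomogeneous 2
  mid : q.IsHomogeneous 2
  right : r.IsHomogeneous 2
  X_mem_radical : ∀ i, X i ∈ (Ideal.span {p, q, r}).radical

namespace IsQuadricCompleteIntersection

variable {p q r : MvPolynomial (Fin 3) K}

theorem rotate (h : IsQuadricCompleteIntersection p q r) :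
    IsQuadricCompleteIntersection q r p where
  left := h.mid
  mid := h.right
  right := h.left
  X_mem_radical := by
    have hset : ({q, r, p} : Set (MvPolynomial (Fin 3) K)) = {p, q, r} := by grind
    exact hset ▸ h.X_mem_radical

theorem ne_zero (h : IsQuadricCompleteIntersection p q r) : p ≠ 0 :=
  ne_zero_of_X_mem_radical h.mid h.right h.X_mem_radical

theorem isRelPrime (h : IsQuadricCompleteIntersection p q r) : IsRelPrime p q :=
  isRelPrime_of_X_mem_radical h.left h.mid h.right h.X_mem_radical

theorem mem_span_pair_of_syzygy (h : IsQuadricCompleteIntersection p q r)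
    {a b c : MvPolynomial (Fin 3) K} (habc : a * p + b * q + c * r = 0) :
    c ∈ Ideal.span {p, q} :=
  mem_span_pair_of_mul_mem h.isRelPrime h.rotate.ne_zero h.X_mem_radical <|
    Ideal.mem_span_pair.mpr ⟨-a, -b, by linear_combination -habc⟩

theorem eq_zero_of_linear_syzygy (h : IsQuadricCompleteIntersection p q r)
    {a b c : MvPolynomial (Fin 3) K} (ha : a.IsHomogeneous 1) (hb : b.IsHomogeneous 1)
    (hc : c.IsHomogeneous 1) (habc : a * p + b * q + c * r = 0) : a = 0 ∧ b = 0 ∧ c = 0 :=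
  ⟨eq_zero_of_mem_span_pair ha h.mid h.right <|
      h.rotate.mem_span_pair_of_syzygy (a := b) (b := c) (by linear_combination habc),
    eq_zero_of_mem_span_pair hb h.right h.left <|
      h.rotate.rotate.mem_span_pair_of_syzygy (a := c) (b := a) (by linear_combination habc),
    eq_zero_of_mem_span_pair hc h.left h.mid <| h.mem_span_pair_of_syzygy habc⟩

/-- Quadratic syzygies are constant combinations of the Koszul syzygies. -/
theorem exists_of_quadratic_syzygy (h : IsQuadricCompleteIntersection p q r)
    {a b c : MvPolynomial (Fin 3) K} (ha : a.IsHomogeneous 2)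
    (hc : c.IsHomogeneous 2) (habc : a * p + b * q + c * r = 0) :
    ∃ u v w : K, a = C w * q - C u * r ∧ b = -(C v * r) - C w * p ∧ c = C u * p + C v * q := by
  obtain ⟨u, v, rfl⟩ := exists_C_of_mem_span_pair h.left h.mid hc (h.mem_span_pair_of_syzygy habc)
  obtain ⟨e, he, he'⟩ := h.isRelPrime.exists_of_mul_add_mul_eq_zero h.rotate.ne_zero
    (a := a + C u * r) (b := b + C v * r) (by linear_combination habc)
  obtain ⟨w, w', hw⟩ := exists_C_of_mem_span_pair h.mid (isHomogeneous_zero _ _ 2)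
    (ha.add (h.right.C_mul u)) (Ideal.mem_span_pair.mpr ⟨e, 0, by rw [he]; ring⟩)
  obtain rfl : e = C w := mul_right_cancel₀ h.rotate.ne_zero (by linear_combination - hw - he)
  exact ⟨u, v, w, by linear_combination he, by linear_combination he', rfl⟩

theorem eq_zero_of_linear_proportional (h : IsQuadricCompleteIntersection p q r)
    {a b : MvPolynomial (Fin 3) K} (ha : a.IsHomogeneous 1) (hab : a * p + b * q = 0) :
    a = 0 := by
  obtain ⟨e, he, -⟩ := h.isRelPrime.exists_of_mul_add_mul_eq_zero h.rotate.ne_zero hab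
  exact eq_zero_of_mem_span_pair ha h.mid h.mid (Ideal.mem_span_pair.mpr ⟨e, 0, by rw [he]; ring⟩)

end IsQuadricCompleteIntersection

theorem isHomogeneous_linear (u v w : K) :
    (X 2 * C u + X 0 * C v + X 1 * C w : MvPolynomial (Fin 3) K).IsHomogeneous 1 := by
  have key (i : Fin 3) (c : K) : (X i * C c : MvPolynomial (Fin 3) K).IsHomogeneous 1 := by
    rw [mul_comm]; exact isHomogeneous_C_mul_X c i
  exact ((key 2 u).add (key 0 v)).add (key 1 w)

theorem eq_zero_of_linear_eq_zero {u v w : K}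
    (h : (X 2 * C u + X 0 * C v + X 1 * C w : MvPolynomial (Fin 3) K) = 0) : u = 0 := by
  simpa using congrArg (eval ![0, 0, 1]) h

namespace IsQuadricCompleteIntersection

variable {p q r : MvPolynomial (Fin 3) K}

/-- The quotient by three quadrics forming a complete intersection has no socle in degree two. -/
theorem mem_of_X_mul_mem (h : IsQuadricCompleteIntersection p q r)
    {f : MvPolynomial (Fin 3) K} (hf : f.IsHomogeneous 2)
    (hX : ∀ i, X i * f ∈ Ideal.span {p, q, r}) : f ∈ Ideal.span {p, q, r} := by
  have hex (i : Fin 3) := exists_isHomogeneous_of_mem_span_triple (n := 1) h.left h.mid h.right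
    ((isHomogeneous_X K i).mul hf) (hX i)
  choose a b c ha hb hc habc using hex
  have hom {s : Fin 3 → MvPolynomial (Fin 3) K} (hs : ∀ i, (s i).IsHomogeneous 1) (i j : Fin 3) :
      (X j * s i - X i * s j).IsHomogeneous 2 :=
    ((isHomogeneous_X K j).mul (hs i)).sub ((isHomogeneous_X K i).mul (hs j))
  have syz (i j : Fin 3) : ∃ u v w : K, X j * a i - X i * a j = C w * q - C u * r ∧
      X j * b i - X i * b j = -(C v * r) - C w * p ∧
      X j * c i - X i * c j = C u * p + C v * q :=
    h.exists_of_quadratic_syzygy (hom ha i j) (hom hc i j)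
      (by linear_combination X j * habc i - X i * habc j)
  obtain ⟨u, v, w, h1, h2, h3⟩ := syz 0 1
  obtain ⟨u', v', w', h1', h2', h3'⟩ := syz 1 2
  obtain ⟨u'', v'', w'', h1'', h2'', h3''⟩ := syz 2 0
  obtain rfl : w = 0 := eq_zero_of_linear_eq_zero <|
    h.rotate.eq_zero_of_linear_proportional (b := -(X 2 * C u + X 0 * C u' + X 1 * C u''))
      (isHomogeneous_linear w w' w'')
      (by linear_combination -(X 2 * h1 + X 0 * h1' + X 1 * h1''))
  obtain rfl : v = 0 := eq_zero_of_linear_eq_zero <|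
    h.rotate.rotate.eq_zero_of_linear_proportional (b := X 2 * C 0 + X 0 * C w' + X 1 * C w'')
      (isHomogeneous_linear v v' v'')
      (by linear_combination (X 2 * h2 + X 0 * h2' + X 1 * h2''))
  obtain rfl : u = 0 := eq_zero_of_linear_eq_zero <|
    h.eq_zero_of_linear_proportional (b := X 2 * C 0 + X 0 * C v' + X 1 * C v'')
      (isHomogeneous_linear u u' u'')
      (by linear_combination -(X 2 * h3 + X 0 * h3' + X 1 * h3''))
  have div {s : Fin 3 → MvPolynomial (Fin 3) K} (hs : X 1 * s 0 - X 0 * s 1 = 0) :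
      ∃ t, s 0 = X 0 * t :=
    exists_eq_mul_of_X_mul_eq_X_mul (by decide) (sub_eq_zero.mp hs)
  obtain ⟨α, hα⟩ := div (s := a) (by simpa using h1)
  obtain ⟨β, hβ⟩ := div (s := b) (by simpa using h2)
  obtain ⟨γ, hγ⟩ := div (s := c) (by simpa using h3)
  refine Submodule.mem_span_triple.mpr ⟨α, β, γ, mul_left_cancel₀ (X_ne_zero (0 : Fin 3)) ?_⟩
  simp only [smul_eq_mul]
  linear_combination habc 0 - p * hα - q * hβ - r * hγ

end IsQuadricCompleteIntersection

section gradedPiece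

local notation "𝒫" => MvPolynomial (Fin 3) ℂ
local notation "ℋ" => homogeneousSubmodule (Fin 3) ℂ

theorem X_mem_radical_of_common_zero {p q r : 𝒫}
    (hz : ∀ x : Fin 3 → ℂ, eval x p = 0 → eval x q = 0 → eval x r = 0 → x = 0) (i : Fin 3) :
    X i ∈ (Ideal.span {p, q, r}).radical := by
  rw [← vanishingIdeal_zeroLocus_eq_radical (K := ℂ), mem_vanishingIdeal_iff]
  intro x hx
  rw [zeroLocus_span] at hx
  obtain rfl : x = 0 := hz x (by simpa using hx p (by simp)) (by simpa using hx q (by simp))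
    (by simpa using hx r (by simp))
  simp

theorem mkQ_restrictScalars_eq_zero_iff {I : Ideal 𝒫} {f : 𝒫} :
    (I.restrictScalars ℂ).mkQ f = 0 ↔ f ∈ I := by
  simp

theorem finrank_gradedPiece_add (I : Ideal 𝒫) (d : ℕ) :
    finrank ℂ (gradedPiece I d) +
      finrank ℂ ((I.restrictScalars ℂ).mkQ.domRestrict (ℋ d)).ker = (d + 2).choose 2 := by
  have : Module.Finite ℂ (ℋ d) := Module.Finite.iff_fg.mpr (homogeneousSubmodule_fg _ _ d)
  rw [← finrank_homogeneousSubmodule (K := ℂ) d,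
    ← ((I.restrictScalars ℂ).mkQ.domRestrict (ℋ d)).finrank_range_add_finrank_ker,
    LinearMap.range_domRestrict]
  rfl

/-- Multiplication by three forms of degree `m`, as a map from triples of forms of degree `n`. -/
def combinationMap {p q r : 𝒫} {m : ℕ} (hp : p.IsHomogeneous m) (hq : q.IsHomogeneous m)
    (hr : r.IsHomogeneous m) (n : ℕ) : (ℋ n × ℋ n × ℋ n) →ₗ[ℂ] ℋ (n + m) where
  toFun l := ⟨l.1 * p + l.2.1 * q + l.2.2 * r,
    ((l.1.2.mul hp).add (l.2.1.2.mul hq)).add (l.2.2.2.mul hr)⟩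
  map_add' l l' := by
    ext1
    simp only [Prod.fst_add, Prod.snd_add, Submodule.coe_add]
    ring
  map_smul' c l := by
    ext1
    simp [smul_add]

theorem range_combinationMap {p q r : 𝒫} {m : ℕ} (hp : p.IsHomogeneous m)
    (hq : q.IsHomogeneous m) (hr : r.IsHomogeneous m) (n : ℕ) :
    (combinationMap hp hq hr n).range =
      (((Ideal.span {p, q, r}).restrictScalars ℂ).mkQ.domRestrict (ℋ (n + m))).ker := by
  ext ⟨f, hf⟩
  rw [LinearMap.mem_ker, LinearMap.domRestrict_apply, mkQ_restrictScalars_eq_zero_iff]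
  constructor
  · rintro ⟨l, hl⟩
    have hl' : (l.1 : 𝒫) * p + l.2.1 * q + l.2.2 * r = f := congrArg Subtype.val hl
    exact Submodule.mem_span_triple.mpr ⟨_, _, _, hl'⟩
  · intro h
    obtain ⟨a, b, c, ha, hb, hc, habc⟩ := exists_isHomogeneous_of_mem_span_triple hp hq hr hf h
    exact ⟨(⟨a, ha⟩, ⟨b, hb⟩, ⟨c, hc⟩), Subtype.ext habc⟩

namespace IsQuadricCompleteIntersection

variable {p q r : 𝒫}

theorem finrank_gradedPiece_three (h : IsQuadricCompleteIntersection p q r) :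
    finrank ℂ (gradedPiece (Ideal.span {p, q, r}) 3) = 1 := by
  have hinj : Function.Injective (combinationMap h.left h.mid h.right 1) := by
    rw [injective_iff_map_eq_zero]
    rintro ⟨⟨a, ha⟩, ⟨b, hb⟩, ⟨c, hc⟩⟩ habc
    obtain ⟨rfl, rfl, rfl⟩ := h.eq_zero_of_linear_syzygy ha hb hc (congrArg Subtype.val habc)
    rfl
  have : Module.Finite ℂ (ℋ 1) := Module.Finite.iff_fg.mpr (homogeneousSubmodule_fg _ _ 1)
  have hker := LinearMap.finrank_range_of_inj hinj
  rw [range_combinationMap, finrank_prod, finrank_prod, finrank_homogeneousSubmodule] at hker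
  have hadd := finrank_gradedPiece_add (Ideal.span {p, q, r}) 3
  simp only [Nat.reduceAdd] at hker hadd
  rw [hker] at hadd
  simpa [Nat.choose] using hadd

theorem three_le_finrank_gradedPiece_two (h : IsQuadricCompleteIntersection p q r) :
    3 ≤ finrank ℂ (gradedPiece (Ideal.span {p, q, r}) 2) := by
  have : Module.Finite ℂ (ℋ 0) := Module.Finite.iff_fg.mpr (homogeneousSubmodule_fg _ _ 0)
  have hker := LinearMap.finrank_range_le (combinationMap h.left h.mid h.right 0)
  rw [range_combinationMap, finrank_prod, finrank_prod, finrank_homogeneousSubmodule] at hker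
  have hadd := finrank_gradedPiece_add (Ideal.span {p, q, r}) 2
  simp only [Nat.reduceAdd, Nat.choose] at hker hadd
  omega

end IsQuadricCompleteIntersection

/-- Multiplication of forms, with values in a graded piece of the quotient. -/
def mulGradedPiece (I : Ideal 𝒫) (m n : ℕ) : ℋ m →ₗ[ℂ] ℋ n →ₗ[ℂ] gradedPiece I (m + n) :=
  LinearMap.mk₂ ℂ (fun f g => ⟨(I.restrictScalars ℂ).mkQ (f * g), f * g, f.2.mul g.2, rfl⟩)
    (fun f f' g => Subtype.ext (by simp [add_mul]))
    (fun c f g => Subtype.ext (by simp))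
    (fun f g g' => Subtype.ext (by simp [mul_add]))
    (fun c f g => Subtype.ext (by simp))

theorem mulGradedPiece_eq_zero_iff {I : Ideal 𝒫} {m n : ℕ} (f : ℋ m) (g : ℋ n) :
    mulGradedPiece I m n f g = 0 ↔ (f * g : 𝒫) ∈ I := by
  rw [← mkQ_restrictScalars_eq_zero_iff]
  exact Subtype.ext_iff

theorem exists_dual_pairing {I : Ideal 𝒫} {m n : ℕ} (h : finrank ℂ (gradedPiece I (m + n)) = 1) :
    ∃ T : ℋ m →ₗ[ℂ] Dual ℂ (ℋ n), ∀ f g, T f g = 0 ↔ (f * g : 𝒫) ∈ I := by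
  obtain ⟨ψ⟩ := Module.nonempty_linearEquiv_of_finrank_eq_one h
  refine ⟨(mulGradedPiece I m n).compr₂ ψ.symm.toLinearMap, fun f g => ?_⟩
  rw [← mulGradedPiece_eq_zero_iff]
  exact ψ.symm.map_eq_zero_iff

namespace IsQuadricCompleteIntersection

variable {p q r : 𝒫}

theorem exists_mul_notMem_of_linear (h : IsQuadricCompleteIntersection p q r) {a : 𝒫}
    (ha : a.IsHomogeneous 1) (h0 : a ≠ 0) :
    ∃ b : 𝒫, b.IsHomogeneous 2 ∧ a * b ∉ Ideal.span {p, q, r} := by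
  have (d : ℕ) : Module.Finite ℂ (ℋ d) := Module.Finite.iff_fg.mpr (homogeneousSubmodule_fg _ _ d)
  obtain ⟨T, hT⟩ := exists_dual_pairing (m := 2) (n := 1) h.finrank_gradedPiece_three
  have hker : T.ker =
      (((Ideal.span {p, q, r}).restrictScalars ℂ).mkQ.domRestrict (ℋ 2)).ker := by
    ext f
    rw [LinearMap.mem_ker, LinearMap.mem_ker, LinearMap.domRestrict_apply,
      mkQ_restrictScalars_eq_zero_iff]
    constructor
    · intro hf
      refine h.mem_of_X_mul_mem f.2 fun i => ?_
      rw [mul_comm]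
      exact (hT f ⟨X i, isHomogeneous_X ℂ i⟩).mp (by rw [hf]; rfl)
    · intro hf
      ext1 g
      exact (hT f g).mpr (Ideal.mul_mem_right _ _ hf)
  have hsurj : T.range = ⊤ := by
    refine Submodule.eq_top_of_finrank_eq (le_antisymm (Submodule.finrank_le _) ?_)
    rw [Subspace.dual_finrank_eq, finrank_homogeneousSubmodule]
    have hrank := T.finrank_range_add_finrank_ker
    rw [hker, finrank_homogeneousSubmodule,
      ← finrank_gradedPiece_add (Ideal.span {p, q, r}) 2] at hrank
    have := h.three_le_finrank_gradedPiece_two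
    simp only [Nat.reduceAdd, Nat.choose]
    omega
  obtain ⟨φ, hφ⟩ := Projective.exists_dual_ne_zero ℂ (x := (⟨a, ha⟩ : ℋ 1))
    (fun hzero => h0 (congrArg Subtype.val hzero))
  obtain ⟨b, rfl⟩ := LinearMap.range_eq_top.mp hsurj φ
  exact ⟨b, b.2, fun hmem => hφ ((hT b ⟨a, ha⟩).mpr (by rwa [mul_comm]))⟩

theorem exists_cubic_notMem (h : IsQuadricCompleteIntersection p q r) :
    ∃ b : 𝒫, b.IsHomogeneous 3 ∧ b ∉ Ideal.span {p, q, r} := by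
  have : Nontrivial (gradedPiece (Ideal.span {p, q, r}) 3) :=
    nontrivial_of_finrank_pos (R := ℂ) (by rw [h.finrank_gradedPiece_three]; exact one_pos)
  obtain ⟨⟨t, b, hb, rfl⟩, ht⟩ := exists_ne (0 : gradedPiece (Ideal.span {p, q, r}) 3)
  exact ⟨b, hb, fun hmem => ht (Subtype.ext (mkQ_restrictScalars_eq_zero_iff.mpr hmem))⟩

end IsQuadricCompleteIntersection

end gradedPiece

/-- Macaulay's theorem for a complete intersection of three quadrics `q₀, q₁, q₂` in
`ℂ[x,y,z]` whose only common zero is the origin: with `I = (q₀,q₁,q₂)` and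
`R_I = ℂ[x,y,z]/I`, the piece `R_I³` is 1-dimensional and the multiplication pairings
`R_I^i ⊗ R_I^{3-i} → R_I³` are perfect: every homogeneous `a` of degree `i ≤ 3` with
`a ∉ I` admits a homogeneous `b` of degree `3 - i` with `a·b ∉ I`. -/
theorem statement19 (q₀ q₁ q₂ : MvPolynomial (Fin 3) ℂ)
    (h₀ : q₀.IsHomogeneous 2) (h₁ : q₁.IsHomogeneous 2) (h₂ : q₂.IsHomogeneous 2)
    (hz : ∀ x : Fin 3 → ℂ, eval x q₀ = 0 → eval x q₁ = 0 → eval x q₂ = 0 → x = 0) :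
    finrank ℂ (gradedPiece (Ideal.span {q₀, q₁, q₂}) 3) = 1 ∧
    ∀ i : ℕ, i ≤ 3 →
      ∀ a : MvPolynomial (Fin 3) ℂ, a.IsHomogeneous i →
        a ∉ Ideal.span ({q₀, q₁, q₂} : Set (MvPolynomial (Fin 3) ℂ)) →
        ∃ b : MvPolynomial (Fin 3) ℂ, b.IsHomogeneous (3 - i) ∧
          a * b ∉ Ideal.span ({q₀, q₁, q₂} : Set (MvPolynomial (Fin 3) ℂ)) := by
  have h : IsQuadricCompleteIntersection q₀ q₁ q₂ :=
    ⟨h₀, h₁, h₂, X_mem_radical_of_common_zero hz⟩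
  refine ⟨h.finrank_gradedPiece_three, fun i hi a ha haI => ?_⟩
  interval_cases i
  · obtain ⟨c, rfl⟩ := exists_C_of_isHomogeneous_zero ha
    obtain ⟨b, hb, hbI⟩ := h.exists_cubic_notMem
    have hc : IsUnit (C c : MvPolynomial (Fin 3) ℂ) := by
      refine (isUnit_iff_ne_zero.mpr ?_).map C
      rintro rfl
      simp at haI
    exact ⟨b, hb, by rwa [Ideal.unit_mul_mem_iff_mem _ hc]⟩
  · exact h.exists_mul_notMem_of_linear ha (by rintro rfl; simp at haI)
  · by_contra! hb
    exact haI <| h.mem_of_X_mul_mem ha fun i => by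
      rw [mul_comm]; exact hb _ (isHomogeneous_X ℂ i)
  · exact ⟨1, isHomogeneous_one _ _, by rwa [mul_one]⟩
end
end
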